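/- If a Δ0 formula Σ(i, a, o) implicitly defines o as a function of i (i.e., Σ(i,a,o) ∧ Σ(i,a',o') entails o = o'), then there exists a Δ0 formula Σ'(i, o) without the auxiliary parameters a such that Σ' also implicitly defines o as a function of i and Σ(i,a,o) entails Σ'(i,o). -/

import Mathlib

inductive NTy : Type
  | ur : NTy
  | unit : NTy
  | prod : NTy → NTy → NTy
  | set : NTy → NTy
deriving DecidableEq

def NObj (U : Type) : NTy → Type
  | .ur => U
  | .unit => Unit
  | .prod a b => NObj U a × NObj U b
  | .set a => Set (NObj U a)

def NObj.asSet {U : Type} {T : NTy} (s : NObj U (NTy.set T)) : Set (NObj U T) := s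

def Env (U : Type) (Γ : List NTy) : Type := (i : Fin Γ.length) → NObj U (Γ.get i)

def Env.nil {U : Type} : Env U [] := fun i => i.elim0

def Env.cons {U : Type} {T : NTy} {Γ : List NTy} (x : NObj U T) (ρ : Env U Γ) :
    Env U (T :: Γ) := fun i =>
  Fin.cases (motive := fun i => NObj U ((T :: Γ).get i)) x (fun j => ρ j) i

inductive Tm : List NTy → NTy → Type
  | var {Γ} (i : Fin Γ.length) : Tm Γ (Γ.get i)
  | unit {Γ} : Tm Γ NTy.unit
  | pair {Γ a b} : Tm Γ a → Tm Γ b → Tm Γ (NTy.prod a b)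
  | fst {Γ a b} : Tm Γ (NTy.prod a b) → Tm Γ a
  | snd {Γ a b} : Tm Γ (NTy.prod a b) → Tm Γ b

def Tm.eval {U : Type} : ∀ {Γ T}, Tm Γ T → Env U Γ → NObj U T
  | _, _, .var i, ρ => ρ i
  | _, _, .unit, _ => ()
  | _, _, .pair s t, ρ => (s.eval ρ, t.eval ρ)
  | _, _, .fst t, ρ => (t.eval ρ).1
  | _, _, .snd t, ρ => (t.eval ρ).2

inductive D0 : List NTy → Type
  | eq {Γ} : Tm Γ NTy.ur → Tm Γ NTy.ur → D0 Γ
  | ne {Γ} : Tm Γ NTy.ur → Tm Γ NTy.ur → D0 Γ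
  | tru {Γ} : D0 Γ
  | fls {Γ} : D0 Γ
  | and {Γ} : D0 Γ → D0 Γ → D0 Γ
  | or {Γ} : D0 Γ → D0 Γ → D0 Γ
  | all {Γ T} : Tm Γ (NTy.set T) → D0 (T :: Γ) → D0 Γ
  | ex {Γ T} : Tm Γ (NTy.set T) → D0 (T :: Γ) → D0 Γ

def D0.Sat {U : Type} : ∀ {Γ}, D0 Γ → Env U Γ → Prop
  | _, .eq s t, ρ => s.eval ρ = t.eval ρ
  | _, .ne s t, ρ => s.eval ρ ≠ t.eval ρ
  | _, .tru, _ => True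
  | _, .fls, _ => False
  | _, .and φ ψ, ρ => φ.Sat ρ ∧ ψ.Sat ρ
  | _, .or φ ψ, ρ => φ.Sat ρ ∨ ψ.Sat ρ
  | _, .all t φ, ρ => ∀ x ∈ NObj.asSet (t.eval ρ), φ.Sat (Env.cons x ρ)
  | _, .ex t φ, ρ => ∃ x ∈ NObj.asSet (t.eval ρ), φ.Sat (Env.cons x ρ)

def Tm.fv : ∀ {Γ T}, Tm Γ T → Finset (Fin Γ.length)
  | _, _, .var i => {i}
  | _, _, .unit => ∅
  | _, _, .pair s t => s.fv ∪ t.fv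
  | _, _, .fst t => t.fv
  | _, _, .snd t => t.fv

def lowerFv {n : ℕ} (s : Finset (Fin (n + 1))) : Finset (Fin n) :=
  Finset.univ.filter (fun j => j.succ ∈ s)

def D0.fv : ∀ {Γ}, D0 Γ → Finset (Fin Γ.length)
  | _, .eq s t => s.fv ∪ t.fv
  | _, .ne s t => s.fv ∪ t.fv
  | _, .tru => ∅
  | _, .fls => ∅
  | _, .and φ ψ => φ.fv ∪ ψ.fv
  | _, .or φ ψ => φ.fv ∪ ψ.fv
  | _, .all t φ => t.fv ∪ lowerFv φ.fv
  | _, .ex t φ => t.fv ∪ lowerFv φ.fv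

/-- The environment binding the three variables `i`, `a`, `o` (de Bruijn indices 0, 1, 2). -/
def mk3 {U : Type} {Ti Ta To : NTy} (i : NObj U Ti) (a : NObj U Ta) (o : NObj U To) :
    Env U [Ti, Ta, To] :=
  Env.cons i (Env.cons a (Env.cons o Env.nil))

namespace DropPar

/-! ### Weakening, substitution, negation, equality formulas -/

def wk {Γ : List NTy} (S : NTy) : ∀ {T}, Tm Γ T → Tm (S :: Γ) T
  | _, .var i => Tm.var (Γ := S :: Γ) i.succ
  | _, .unit => .unit
  | _, .pair s t => .pair (wk S s) (wk S t)
  | _, .fst t => .fst (wk S t)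
  | _, .snd t => .snd (wk S t)

def v0 {Γ : List NTy} (S : NTy) : Tm (S :: Γ) S :=
  Tm.var (Γ := S :: Γ) (0 : Fin (Γ.length + 1))

theorem eval_var {U : Type} {Γ : List NTy} (i : Fin Γ.length) (ρ : Env U Γ) :
    (Tm.var i).eval ρ = ρ i := by simp only [Tm.eval]

theorem fv_var {Γ : List NTy} (i : Fin Γ.length) : (Tm.var i).fv = {i} := by
  simp only [Tm.fv]

theorem fv_v0 {Γ : List NTy} (S : NTy) :
    (v0 (Γ := Γ) S).fv = ({(0 : Fin (Γ.length + 1))} : Finset (Fin (Γ.length + 1))) :=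
  fv_var (Γ := S :: Γ) (0 : Fin (Γ.length + 1))

theorem eval_v0 {U : Type} {Γ : List NTy} {S : NTy} (x : NObj U S) (ρ : Env U Γ) :
    (v0 S).eval (Env.cons x ρ) = x := by
  exact eval_var (Γ := S :: Γ) (0 : Fin (Γ.length + 1)) (Env.cons x ρ)

theorem eval_wk {U : Type} {Γ : List NTy} {S T : NTy} (t : Tm Γ T) (x : NObj U S)
    (ρ : Env U Γ) : (wk S t).eval (Env.cons x ρ) = t.eval ρ := by
  induction t with
  | var i => simp only [wk, Tm.eval]; rfl
  | unit => rfl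
  | pair s t h1 h2 => simp only [wk, Tm.eval, h1, h2]; rfl
  | fst t h => simp only [wk, Tm.eval, h]
  | snd t h => simp only [wk, Tm.eval, h]

def Sub (Γ Δ : List NTy) : Type := ∀ i : Fin Γ.length, Tm Δ (Γ.get i)

def Sub.lift {Γ Δ : List NTy} (S : NTy) (σ : Sub Γ Δ) : Sub (S :: Γ) (S :: Δ) := fun i =>
  Fin.cases (motive := fun i => Tm (S :: Δ) ((S :: Γ).get i)) (v0 S) (fun j => wk S (σ j)) i

def substT {Γ Δ : List NTy} (σ : Sub Γ Δ) : ∀ {T}, Tm Γ T → Tm Δ T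
  | _, .var i => σ i
  | _, .unit => .unit
  | _, .pair s t => .pair (substT σ s) (substT σ t)
  | _, .fst t => .fst (substT σ t)
  | _, .snd t => .snd (substT σ t)

def subst : ∀ {Γ Δ : List NTy}, Sub Γ Δ → D0 Γ → D0 Δ
  | _, _, σ, .eq s t => .eq (substT σ s) (substT σ t)
  | _, _, σ, .ne s t => .ne (substT σ s) (substT σ t)
  | _, _, _, .tru => .tru
  | _, _, _, .fls => .fls
  | _, _, σ, .and φ ψ => .and (subst σ φ) (subst σ ψ)
  | _, _, σ, .or φ ψ => .or (subst σ φ) (subst σ ψ)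
  | _, _, σ, .all t φ => .all (substT σ t) (subst (σ.lift _) φ)
  | _, _, σ, .ex t φ => .ex (substT σ t) (subst (σ.lift _) φ)

def Sub.ev {U : Type} {Γ Δ : List NTy} (σ : Sub Γ Δ) (ρ : Env U Δ) : Env U Γ :=
  fun i => (σ i).eval ρ

theorem eval_substT {U : Type} {Γ Δ : List NTy} {T : NTy} (σ : Sub Γ Δ) (t : Tm Γ T)
    (ρ : Env U Δ) : (substT σ t).eval ρ = t.eval (σ.ev ρ) := by
  induction t with
  | var i => simp only [substT, Tm.eval]; rfl
  | unit => rfl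
  | pair s t h1 h2 => simp only [substT, Tm.eval, h1, h2]; rfl
  | fst t h => simp only [substT, Tm.eval, h]
  | snd t h => simp only [substT, Tm.eval, h]

theorem lift_ev {U : Type} {Γ Δ : List NTy} {S : NTy} (σ : Sub Γ Δ) (x : NObj U S)
    (ρ : Env U Δ) : (σ.lift S).ev (Env.cons x ρ) = Env.cons x (σ.ev ρ) := by
  funext i
  refine Fin.cases (motive := fun i => (σ.lift S).ev (Env.cons x ρ) i
    = Env.cons x (σ.ev ρ) i) ?_ (fun j => ?_) i
  · exact eval_v0 x ρ
  · exact eval_wk (σ j) x ρ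

theorem sat_subst {U : Type} {Γ : List NTy} (φ : D0 Γ) : ∀ {Δ : List NTy} (σ : Sub Γ Δ)
    (ρ : Env U Δ), (subst σ φ).Sat ρ ↔ φ.Sat (σ.ev ρ) := by
  induction φ with
  | eq s t => intro Δ σ ρ; simp only [subst, D0.Sat, eval_substT]
  | ne s t => intro Δ σ ρ; simp only [subst, D0.Sat, eval_substT]
  | tru => intro Δ σ ρ; simp only [subst, D0.Sat]
  | fls => intro Δ σ ρ; simp only [subst, D0.Sat]
  | and φ ψ h1 h2 => intro Δ σ ρ; simp only [subst, D0.Sat, h1, h2]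
  | or φ ψ h1 h2 => intro Δ σ ρ; simp only [subst, D0.Sat, h1, h2]
  | all t φ h => intro Δ σ ρ; simp only [subst, D0.Sat, h, eval_substT, lift_ev]
  | ex t φ h => intro Δ σ ρ; simp only [subst, D0.Sat, h, eval_substT, lift_ev]

theorem fv_wk {Γ : List NTy} {S T : NTy} (t : Tm Γ T) (i : Fin (Γ.length + 1))
    (h : i ∈ (wk S t).fv) : ∃ j ∈ t.fv, i = Fin.succ j := by
  induction t with
  | var j =>
    refine ⟨j, by simp [Tm.fv], ?_⟩
    simp only [wk, Tm.fv] at h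
    exact Finset.mem_singleton.1 h
  | unit => simp [wk, Tm.fv] at h
  | pair s t h1 h2 =>
    simp only [wk, Tm.fv, Finset.mem_union] at h ⊢
    rcases h with h | h
    · obtain ⟨j, hj, e⟩ := h1 h; exact ⟨j, Or.inl hj, e⟩
    · obtain ⟨j, hj, e⟩ := h2 h; exact ⟨j, Or.inr hj, e⟩
  | fst t h' => simp only [wk, Tm.fv] at h ⊢; exact h' h
  | snd t h' => simp only [wk, Tm.fv] at h ⊢; exact h' h

theorem fv_substT {Γ Δ : List NTy} {T : NTy} (σ : Sub Γ Δ) (t : Tm Γ T)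
    (S : Finset (Fin Δ.length)) (hS : ∀ i, (σ i).fv ⊆ S) : (substT σ t).fv ⊆ S := by
  induction t with
  | var i => exact hS i
  | unit => simp [substT, Tm.fv]
  | pair s t h1 h2 => simp only [substT, Tm.fv]; exact Finset.union_subset h1 h2
  | fst t h => simp only [substT, Tm.fv]; exact h
  | snd t h => simp only [substT, Tm.fv]; exact h

theorem fv_lift {Γ Δ : List NTy} (T : NTy) (σ : Sub Γ Δ) (S : Finset (Fin Δ.length))
    (hS : ∀ i, (σ i).fv ⊆ S) (i : Fin (T :: Γ).length) :
    ((σ.lift T) i).fv ⊆ (insert (0 : Fin (Δ.length + 1)) (S.image Fin.succ)) := by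
  refine Fin.cases (motive := fun i => ((σ.lift T) i).fv ⊆
    (insert (0 : Fin (Δ.length + 1)) (S.image Fin.succ))) ?_ (fun j => ?_) i
  · intro k hk
    change k ∈ (v0 T).fv at hk
    have : k = (0 : Fin (Δ.length + 1)) := Finset.mem_singleton.1 ((fv_v0 T).subset hk)
    rw [this]; exact Finset.mem_insert_self _ _
  · intro k hk
    obtain ⟨j', hj', e⟩ := fv_wk (σ j) k hk
    rw [e]
    exact Finset.mem_insert_of_mem (Finset.mem_image_of_mem _ (hS j hj'))

theorem lower_sub {n : ℕ} (S : Finset (Fin n)) (A : Finset (Fin (n + 1)))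
    (h : A ⊆ insert (0 : Fin (n + 1)) (S.image Fin.succ)) : lowerFv A ⊆ S := by
  intro j hj
  have := h (Finset.mem_filter.1 hj).2
  simpa [Fin.succ_ne_zero] using this

theorem fv_subst {Γ : List NTy} (φ : D0 Γ) : ∀ {Δ : List NTy} (σ : Sub Γ Δ)
    (S : Finset (Fin Δ.length)) (_ : ∀ i, (σ i).fv ⊆ S), (subst σ φ).fv ⊆ S := by
  induction φ with
  | eq s t => intro Δ σ S hS; exact Finset.union_subset (fv_substT σ s S hS) (fv_substT σ t S hS)
  | ne s t => intro Δ σ S hS; exact Finset.union_subset (fv_substT σ s S hS) (fv_substT σ t S hS)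
  | tru => intro Δ σ S hS; exact Finset.empty_subset _
  | fls => intro Δ σ S hS; exact Finset.empty_subset _
  | and φ ψ h1 h2 => intro Δ σ S hS; exact Finset.union_subset (h1 σ S hS) (h2 σ S hS)
  | or φ ψ h1 h2 => intro Δ σ S hS; exact Finset.union_subset (h1 σ S hS) (h2 σ S hS)
  | all t φ h =>
    intro Δ σ S hS
    exact Finset.union_subset (fv_substT σ t S hS)
      (lower_sub S _ (h (σ.lift _) _ (fv_lift _ σ S hS)))
  | ex t φ h =>
    intro Δ σ S hS
    exact Finset.union_subset (fv_substT σ t S hS)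
      (lower_sub S _ (h (σ.lift _) _ (fv_lift _ σ S hS)))

def neg : ∀ {Γ : List NTy}, D0 Γ → D0 Γ
  | _, .eq s t => .ne s t
  | _, .ne s t => .eq s t
  | _, .tru => .fls
  | _, .fls => .tru
  | _, .and φ ψ => .or (neg φ) (neg ψ)
  | _, .or φ ψ => .and (neg φ) (neg ψ)
  | _, .all t φ => .ex t (neg φ)
  | _, .ex t φ => .all t (neg φ)

theorem sat_neg {U : Type} {Γ : List NTy} (φ : D0 Γ) : ∀ (ρ : Env U Γ),
    (neg φ).Sat ρ ↔ ¬ φ.Sat ρ := by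
  induction φ with
  | eq s t => intro ρ; simp only [neg, D0.Sat, ne_eq]
  | ne s t => intro ρ; simp only [neg, D0.Sat, ne_eq, not_not]
  | tru => intro ρ; simp only [neg, D0.Sat, not_true]
  | fls => intro ρ; simp only [neg, D0.Sat, not_false_iff]
  | and φ ψ h1 h2 => intro ρ; simp only [neg, D0.Sat, h1, h2]; tauto
  | or φ ψ h1 h2 => intro ρ; simp only [neg, D0.Sat, h1, h2]; tauto
  | all t φ h => intro ρ; simp only [neg, D0.Sat, h]; push Not; rfl
  | ex t φ h => intro ρ; simp only [neg, D0.Sat, h]; push Not; rfl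

def eqF : ∀ (T : NTy) {Γ : List NTy}, Tm Γ T → Tm Γ T → D0 Γ
  | .ur, _, s, t => .eq s t
  | .unit, _, _, _ => .tru
  | .prod a b, _, s, t => .and (eqF a (.fst s) (.fst t)) (eqF b (.snd s) (.snd t))
  | .set a, _, s, t =>
    .and (.all s (.ex (wk a t) (eqF a (wk a (v0 a)) (v0 a))))
      (.all t (.ex (wk a s) (eqF a (wk a (v0 a)) (v0 a))))

theorem sat_eqF {U : Type} (T : NTy) : ∀ {Γ : List NTy} (s t : Tm Γ T) (ρ : Env U Γ),
    (eqF T s t).Sat ρ ↔ s.eval ρ = t.eval ρ := by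
  induction T with
  | ur => intro Γ s t ρ; rfl
  | unit => intro Γ s t ρ; exact ⟨fun _ => rfl, fun _ => trivial⟩
  | prod a b h1 h2 =>
    intro Γ s t ρ
    simp only [eqF, D0.Sat, h1, h2, Tm.eval]
    exact ⟨fun h => Prod.ext h.1 h.2, fun h => by rw [h]; exact ⟨rfl, rfl⟩⟩
  | set a h =>
    intro Γ s t ρ
    simp only [eqF, D0.Sat, h, eval_wk, eval_v0]
    constructor
    · rintro ⟨h1, h2⟩
      apply Set.ext (α := NObj U a)
      intro x
      constructor
      · intro hx; obtain ⟨y, hy, e⟩ := h1 x hx; rw [e]; exact hy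
      · intro hx; obtain ⟨y, hy, e⟩ := h2 x hx; rw [e]; exact hy
    · intro e
      rw [e]
      exact ⟨fun x hx => ⟨x, hx, rfl⟩, fun x hx => ⟨x, hx, rfl⟩⟩

/-! ### Transport along injections of universes -/

def mp {U W : Type} (f : U → W) : ∀ T, NObj U T → NObj W T
  | .ur => f
  | .unit => fun _ => ()
  | .prod a b => fun x => (mp f a x.1, mp f b x.2)
  | .set a => fun s => (Set.image (mp f a) s : Set (NObj W a))

theorem mp_inj {U W : Type} (f : U → W) (hf : Function.Injective f) (T : NTy) :
    Function.Injective (mp f T) := by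
  induction T with
  | ur => exact hf
  | unit => intro x y _; rfl
  | prod a b h1 h2 =>
    intro x y h
    have h' := Prod.ext_iff.1 h
    exact Prod.ext (h1 h'.1) (h2 h'.2)
  | set a h => exact Set.image_injective.2 h

def mpE {U W : Type} (f : U → W) {Γ : List NTy} (ρ : Env U Γ) : Env W Γ :=
  fun i => mp f _ (ρ i)

theorem mpE_cons {U W : Type} (f : U → W) {Γ : List NTy} {T : NTy} (x : NObj U T)
    (ρ : Env U Γ) : mpE f (Env.cons x ρ) = Env.cons (mp f T x) (mpE f ρ) := by
  funext i
  refine Fin.cases (motive := fun i => mpE f (Env.cons x ρ) i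
    = Env.cons (mp f T x) (mpE f ρ) i) ?_ (fun j => ?_) i <;> rfl

theorem eval_mp {U W : Type} (f : U → W) {Γ : List NTy} {T : NTy} (t : Tm Γ T)
    (ρ : Env U Γ) : t.eval (mpE f ρ) = mp f T (t.eval ρ) := by
  induction t with
  | var i => simp only [Tm.eval]; rfl
  | unit => rfl
  | pair s t h1 h2 => simp only [Tm.eval, h1, h2]; rfl
  | fst t h => simp only [Tm.eval, h]; rfl
  | snd t h => simp only [Tm.eval, h]; rfl

theorem sat_mp {U W : Type} (f : U → W) (hf : Function.Injective f) {Γ : List NTy}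
    (φ : D0 Γ) : ∀ ρ : Env U Γ, φ.Sat (mpE f ρ) ↔ φ.Sat ρ := by
  induction φ with
  | eq s t => intro ρ; simp only [D0.Sat, eval_mp]; exact (mp_inj f hf .ur).eq_iff
  | ne s t => intro ρ; simp only [D0.Sat, eval_mp]; exact (mp_inj f hf .ur).ne_iff
  | tru => intro ρ; simp only [D0.Sat]
  | fls => intro ρ; simp only [D0.Sat]
  | and φ ψ h1 h2 => intro ρ; simp only [D0.Sat, h1, h2]
  | or φ ψ h1 h2 => intro ρ; simp only [D0.Sat, h1, h2]
  | @all Γ T t φ h =>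
    intro ρ
    simp only [D0.Sat, eval_mp]
    constructor
    · intro H x hx
      have := H (mp f T x) ⟨x, hx, rfl⟩
      rwa [← mpE_cons, h] at this
    · rintro H _ ⟨x, hx, rfl⟩
      rw [← mpE_cons, h]
      exact H x hx
  | @ex Γ T t φ h =>
    intro ρ
    simp only [D0.Sat, eval_mp]
    constructor
    · rintro ⟨_, ⟨x, hx, rfl⟩, H⟩
      rw [← mpE_cons, h] at H
      exact ⟨x, hx, H⟩
    · rintro ⟨x, hx, H⟩
      refine ⟨mp f T x, ⟨x, hx, rfl⟩, ?_⟩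
      rwa [← mpE_cons, h]

/-! ### Names, valuations, items -/

/-- A name: `none` for shared names, `some b` for names private to side `b`. -/
abbrev Nm : Type := Option Bool × ℕ

def V : NTy → Type
  | .ur => Nm
  | .unit => Unit
  | .prod a b => V a × V b
  | .set _ => Nm

def VEnv (Γ : List NTy) : Type := (i : Fin Γ.length) → V (Γ.get i)

def VEnv.nil : VEnv [] := fun i => i.elim0

def VEnv.cons {T : NTy} {Γ : List NTy} (x : V T) (ρ : VEnv Γ) : VEnv (T :: Γ) := fun i =>
  Fin.cases (motive := fun i => V ((T :: Γ).get i)) x (fun j => ρ j) i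

def evalV {Γ : List NTy} (ρ : VEnv Γ) : ∀ {T}, Tm Γ T → V T
  | _, .var i => ρ i
  | _, .unit => ()
  | _, .pair s t => (evalV ρ s, evalV ρ t)
  | _, .fst t => (evalV ρ t).1
  | _, .snd t => (evalV ρ t).2

theorem evalV_wk {Γ : List NTy} {S T : NTy} (t : Tm Γ T) (x : V S)
    (ρ : VEnv Γ) : evalV (VEnv.cons x ρ) (wk S t) = evalV ρ t := by
  induction t with
  | var i => rfl
  | unit => rfl
  | pair s t h1 h2 => simp only [wk, evalV, h1, h2]; rfl
  | fst t h => simp only [wk, evalV, h]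
  | snd t h => simp only [wk, evalV, h]

structure Val (U : Type) : Type where
  u : Nm → U
  s : ∀ T : NTy, Nm → Set (NObj U T)

def Val.app {U : Type} (v : Val U) : ∀ T, V T → NObj U T
  | .ur => v.u
  | .unit => fun _ => ()
  | .prod a b => fun x => (v.app a x.1, v.app b x.2)
  | .set a => v.s a

def Val.env {U : Type} (v : Val U) {Γ : List NTy} (ρ : VEnv Γ) : Env U Γ :=
  fun i => v.app _ (ρ i)

theorem env_cons {U : Type} (v : Val U) {Γ : List NTy} {T : NTy} (x : V T) (ρ : VEnv Γ) :
    v.env (VEnv.cons x ρ) = Env.cons (v.app T x) (v.env ρ) := by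
  funext i
  refine Fin.cases (motive := fun i => v.env (VEnv.cons x ρ) i
    = Env.cons (v.app T x) (v.env ρ) i) ?_ (fun j => ?_) i <;> rfl

theorem env_nil {U : Type} (v : Val U) : v.env VEnv.nil = Env.nil := by
  funext i; exact i.elim0

theorem eval_env {U : Type} (v : Val U) {Γ : List NTy} {T : NTy} (t : Tm Γ T) (ρ : VEnv Γ) :
    t.eval (v.env ρ) = v.app T (evalV ρ t) := by
  induction t with
  | var i => simp only [Tm.eval]; rfl
  | unit => rfl
  | pair s t h1 h2 => simp only [Tm.eval, h1, h2]; rfl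
  | fst t h => simp only [Tm.eval, h]; rfl
  | snd t h => simp only [Tm.eval, h]; rfl

abbrev NPred : Type := NTy → Nm → Prop

def ok (P : NPred) : ∀ T, V T → Prop
  | .ur => fun n => P .ur n
  | .unit => fun _ => True
  | .prod a b => fun x => ok P a x.1 ∧ ok P b x.2
  | .set a => fun n => P (.set a) n

theorem ok_mono {P Q : NPred} (h : ∀ T n, P T n → Q T n) (T : NTy) :
    ∀ x : V T, ok P T x → ok Q T x := by
  induction T with
  | ur => intro x hx; exact h _ _ hx
  | unit => intro x hx; trivial
  | prod a b h1 h2 => intro x hx; exact ⟨h1 _ hx.1, h2 _ hx.2⟩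
  | set a _ => intro x hx; exact h _ _ hx

theorem ok_and {P Q : NPred} (T : NTy) :
    ∀ x : V T, ok P T x → ok Q T x → ok (fun T n => P T n ∧ Q T n) T x := by
  induction T with
  | ur => intro x hx hy; exact ⟨hx, hy⟩
  | unit => intro x hx hy; trivial
  | prod a b h1 h2 => intro x hx hy; exact ⟨h1 _ hx.1 hy.1, h2 _ hx.2 hy.2⟩
  | set a _ => intro x hx hy; exact ⟨hx, hy⟩

def okE (P : NPred) {Γ : List NTy} (ρ : VEnv Γ) : Prop := ∀ i, ok P _ (ρ i)

theorem okE_mono {P Q : NPred} (h : ∀ T n, P T n → Q T n) {Γ : List NTy} (ρ : VEnv Γ)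
    (hr : okE P ρ) : okE Q ρ := fun i => ok_mono h _ _ (hr i)

theorem okE_cons {P : NPred} {Γ : List NTy} {T : NTy} (x : V T) (ρ : VEnv Γ)
    (hx : ok P T x) (hr : okE P ρ) : okE P (VEnv.cons x ρ) := by
  intro i
  refine Fin.cases (motive := fun i => ok P _ (VEnv.cons x ρ i)) ?_ (fun j => ?_) i
  · exact hx
  · exact hr j

theorem okE_nil {P : NPred} : okE P VEnv.nil := fun i => i.elim0

theorem ok_evalV {P : NPred} {Γ : List NTy} (ρ : VEnv Γ) (hr : okE P ρ) {T : NTy}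
    (t : Tm Γ T) : ok P T (evalV ρ t) := by
  induction t with
  | var i => exact hr i
  | unit => trivial
  | pair s t h1 h2 => exact ⟨h1, h2⟩
  | fst t h => exact h.1
  | snd t h => exact h.2

def Agree {U : Type} (P : NPred) (v w : Val U) : Prop :=
  (∀ n, P .ur n → v.u n = w.u n) ∧ ∀ T n, P (.set T) n → v.s T n = w.s T n

theorem Agree.mono {U : Type} {P Q : NPred} {v w : Val U} (h : Agree P v w)
    (hPQ : ∀ T n, Q T n → P T n) : Agree Q v w :=
  ⟨fun n hn => h.1 n (hPQ _ _ hn), fun T n hn => h.2 T n (hPQ _ _ hn)⟩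

theorem Agree.trans {U : Type} {P : NPred} {v w z : Val U} (h : Agree P v w)
    (h' : Agree P w z) : Agree P v z :=
  ⟨fun n hn => (h.1 n hn).trans (h'.1 n hn), fun T n hn => (h.2 T n hn).trans (h'.2 T n hn)⟩

theorem app_agree {U : Type} {P : NPred} {v w : Val U} (h : Agree P v w) (T : NTy) :
    ∀ x : V T, ok P T x → v.app T x = w.app T x := by
  induction T with
  | ur => intro x hx; exact h.1 x hx
  | unit => intro x hx; rfl
  | prod a b h1 h2 => intro x hx; exact Prod.ext (h1 _ hx.1) (h2 _ hx.2)
  | set a _ => intro x hx; exact h.2 a x hx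

theorem env_agree {U : Type} {P : NPred} {v w : Val U} (h : Agree P v w) {Γ : List NTy}
    (ρ : VEnv Γ) (hr : okE P ρ) : v.env ρ = w.env ρ :=
  funext fun i => app_agree h _ _ (hr i)

theorem fresh (T : NTy) : ∀ (c : Option Bool) (N : ℕ), ∃ (x : V T) (M : ℕ), N ≤ M ∧
    ok (fun _ n => n.1 = c ∧ n.2 < M) T x ∧
    ∀ (U : Type) (v : Val U) (y : NObj U T), ∃ w : Val U, w.app T x = y ∧
      Agree (fun _ n => n.2 < N) v w := by
  classical
  induction T with
  | ur =>
    intro c N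
    refine ⟨((c, N) : Nm), N + 1, Nat.le_succ N, ⟨rfl, Nat.lt_succ_self N⟩, ?_⟩
    intro U v y
    refine ⟨⟨Function.update v.u (c, N) y, v.s⟩, ?_, ?_, ?_⟩
    · exact Function.update_self (c, N) y v.u
    · intro n hn
      refine (Function.update_of_ne ?_ _ _).symm
      rintro rfl; exact lt_irrefl _ hn
    · intro T n _; rfl
  | unit =>
    intro c N
    exact ⟨(), N, le_refl N, trivial, fun U v y => ⟨v, rfl, fun _ _ => rfl, fun _ _ _ => rfl⟩⟩
  | prod a b h1 h2 =>
    intro c N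
    obtain ⟨x1, M1, hM1, ok1, f1⟩ := h1 c N
    obtain ⟨x2, M2, hM2, ok2, f2⟩ := h2 c M1
    refine ⟨(x1, x2), M2, hM1.trans hM2,
      ⟨ok_mono (fun _ n h => ⟨h.1, h.2.trans_le hM2⟩) _ _ ok1, ok2⟩, ?_⟩
    intro U v y
    obtain ⟨w1, e1, g1⟩ := f1 U v y.1
    obtain ⟨w2, e2, g2⟩ := f2 U w1 y.2
    refine ⟨w2, Prod.ext ?_ e2, g1.trans (g2.mono fun _ n hn => lt_of_lt_of_le hn hM1)⟩
    rw [← e1]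
    exact (app_agree g2 a x1 (ok_mono (fun _ n h => h.2) _ _ ok1)).symm
  | set a _ =>
    intro c N
    refine ⟨((c, N) : Nm), N + 1, Nat.le_succ N, ⟨rfl, Nat.lt_succ_self N⟩, ?_⟩
    intro U v y
    refine ⟨⟨v.u, Function.update v.s a (Function.update (v.s a) (c, N) y)⟩, ?_, ?_, ?_⟩
    · show Function.update v.s a (Function.update (v.s a) (c, N) y) a (c, N) = y
      rw [Function.update_self]
      exact Function.update_self (c, N) y (v.s a)
    · intro n _; rfl
    · intro T n hn
      show v.s T n = Function.update v.s a (Function.update (v.s a) (c, N) y) T n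
      by_cases hT : T = a
      · subst hT
        rw [Function.update_self]
        refine (Function.update_of_ne ?_ _ _).symm
        rintro rfl; exact lt_irrefl _ hn
      · rw [Function.update_of_ne hT]

inductive Item : Type
  | fml (Γ : List NTy) (φ : D0 Γ) (ρ : VEnv Γ) : Item
  | mem (T : NTy) (x : V T) (s : Nm) : Item
  | eq (m n : Nm) : Item

def Item.ok (P : NPred) : Item → Prop
  | .fml _ _ ρ => okE P ρ
  | .mem T x s => DropPar.ok P T x ∧ P (.set T) s
  | .eq m n => P .ur m ∧ P .ur n

def Item.holds {U : Type} (v : Val U) : Item → Prop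
  | .fml _ φ ρ => φ.Sat (v.env ρ)
  | .mem T x s => v.app T x ∈ v.s T s
  | .eq m n => v.u m = v.u n

theorem Item.ok_mono {P Q : NPred} (h : ∀ T n, P T n → Q T n) (A : Item) (hA : A.ok P) :
    A.ok Q := by
  cases A with
  | fml Γ φ ρ => exact okE_mono h ρ hA
  | mem T x s => exact ⟨DropPar.ok_mono h T x hA.1, h _ _ hA.2⟩
  | eq m n => exact ⟨h _ _ hA.1, h _ _ hA.2⟩

theorem Item.holds_agree {U : Type} {P : NPred} {v w : Val U} (h : Agree P v w) (A : Item)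
    (hA : A.ok P) (hv : A.holds v) : A.holds w := by
  cases A with
  | fml Γ φ ρ => simpa only [Item.holds, env_agree h ρ hA] using hv
  | mem T x s =>
    simp only [Item.holds] at hv ⊢
    rw [← app_agree h T x hA.1, ← h.2 T s hA.2]; exact hv
  | eq m n =>
    simp only [Item.holds] at hv ⊢
    rw [← h.1 m hA.1, ← h.1 n hA.2]; exact hv

def Holds {U : Type} (v : Val U) (l : List Item) : Prop := ∀ A ∈ l, A.holds v

/-! ### Separability and states -/

def Sep (Γ : List NTy) (ρ : VEnv Γ) (l : Bool → List Item) : Prop :=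
  ∃ θ : D0 Γ, (∀ (U : Type) (v : Val U), Holds v (l true) → θ.Sat (v.env ρ)) ∧
    (∀ (U : Type) (v : Val U), Holds v (l false) → ¬ θ.Sat (v.env ρ))

theorem sep_iff (b : Bool) (Γ : List NTy) (ρ : VEnv Γ) (l : Bool → List Item) :
    Sep Γ ρ l ↔ ∃ θ : D0 Γ, (∀ (U : Type) (v : Val U), Holds v (l b) → θ.Sat (v.env ρ)) ∧
    (∀ (U : Type) (v : Val U), Holds v (l (!b)) → ¬ θ.Sat (v.env ρ)) := by
  cases b with
  | true => rfl
  | false =>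
    constructor
    · rintro ⟨θ, h1, h2⟩
      exact ⟨neg θ, fun U v h => (sat_neg _ _).2 (h2 U v h),
        fun U v h h' => (sat_neg _ _).1 h' (h1 U v h)⟩
    · rintro ⟨θ, h1, h2⟩
      exact ⟨neg θ, fun U v h => (sat_neg _ _).2 (h2 U v h),
        fun U v h h' => (sat_neg _ _).1 h' (h1 U v h)⟩

/-- Definability of a name from the shared context. -/
def Dfn (Γ : List NTy) (ρ : VEnv Γ) : NPred
  | .ur, n => ∃ t : Tm Γ .ur, evalV ρ t = n
  | .set T, n => ∃ t : Tm Γ (.set T), evalV ρ t = n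
  | _, _ => True

theorem ok_dfn {Γ : List NTy} (ρ : VEnv Γ) (T : NTy) : ∀ t : Tm Γ T,
    ok (Dfn Γ ρ) T (evalV ρ t) := by
  induction T with
  | ur => intro t; exact ⟨t, rfl⟩
  | unit => intro t; trivial
  | prod a b h1 h2 => intro t; exact ⟨h1 (.fst t), h2 (.snd t)⟩
  | set a _ => intro t; exact ⟨t, rfl⟩

theorem dfn_wk {Γ : List NTy} (ρ : VEnv Γ) {S : NTy} (x : V S) (T : NTy) (n : Nm)
    (h : Dfn Γ ρ T n) : Dfn (S :: Γ) (VEnv.cons x ρ) T n := by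
  cases T with
  | ur => obtain ⟨t, e⟩ := h; exact ⟨wk S t, (evalV_wk t x ρ).trans e⟩
  | set T => obtain ⟨t, e⟩ := h; exact ⟨wk S t, (evalV_wk t x ρ).trans e⟩
  | unit => trivial
  | prod a b => trivial

def SP (Γ : List NTy) (ρ : VEnv Γ) (N : ℕ) (b : Bool) : NPred := fun T n =>
  n.2 < N ∧ (n.1 = some b ∨ (n.1 = none ∧ Dfn Γ ρ T n))

theorem SP_mono {Γ : List NTy} {ρ : VEnv Γ} {N M : ℕ} (h : N ≤ M) {b : Bool} (T : NTy) (n : Nm)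
    (hn : SP Γ ρ N b T n) : SP Γ ρ M b T n := ⟨hn.1.trans_le h, hn.2⟩

structure St : Type where
  Γ : List NTy
  ρ : VEnv Γ
  l : Bool → List Item
  N : ℕ
  okr : okE (fun _ n => n.2 < N) ρ
  okl : ∀ b, ∀ A ∈ l b, A.ok (SP Γ ρ N b)
  sync : ∀ b T x s, Item.mem T x s ∈ l b → s.1 = none → Item.mem T x s ∈ l (!b)
  insep : ¬ Sep Γ ρ l

instance : Preorder St where
  le p q := ∀ b, p.l b <+: q.l b
  le_refl p b := List.prefix_refl _
  le_trans p q r h1 h2 b := (h1 b).trans (h2 b)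

theorem St.le_def {p q : St} : p ≤ q ↔ ∀ b, p.l b <+: q.l b := Iff.rfl

def upd (l : Bool → List Item) (b : Bool) (As : List Item) : Bool → List Item :=
  fun c => if c = b then l c ++ As else l c

theorem upd_self (l : Bool → List Item) (b : Bool) (As : List Item) :
    upd l b As b = l b ++ As := if_pos rfl

theorem upd_not (l : Bool → List Item) (b : Bool) (As : List Item) :
    upd l b As (!b) = l (!b) := if_neg (by cases b <;> simp)

theorem upd_ext (l : Bool → List Item) (b : Bool) (As : List Item) (c : Bool) :
    l c <+: upd l b As c := by
  unfold upd
  split_ifs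
  · exact List.prefix_append _ _
  · exact List.prefix_refl _

theorem holds_append {U : Type} (v : Val U) (l m : List Item) :
    Holds v (l ++ m) ↔ Holds v l ∧ Holds v m := by
  simp only [Holds, List.mem_append]
  exact ⟨fun h => ⟨fun A hA => h A (Or.inl hA), fun A hA => h A (Or.inr hA)⟩,
    fun h A hA => hA.elim (h.1 A) (h.2 A)⟩

/-- Extend one side of a state, keeping the shared context. -/
theorem ext_side (p : St) (b : Bool) (As : List Item) (M : ℕ) (hM : p.N ≤ M)
    (hok : ∀ A ∈ As, A.ok (SP p.Γ p.ρ M b))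
    (hmem : ∀ T x s, Item.mem T x s ∈ As → s.1 ≠ none)
    (hins : ¬ Sep p.Γ p.ρ (upd p.l b As)) :
    ∃ q : St, p ≤ q ∧ ∀ A ∈ As, A ∈ q.l b := by
  refine ⟨⟨p.Γ, p.ρ, upd p.l b As, M, okE_mono (fun _ n h => lt_of_lt_of_le h hM) _ p.okr,
    ?_, ?_, hins⟩, fun c => upd_ext _ _ _ _, ?_⟩
  · intro c A hA
    by_cases hc : c = b
    · subst hc
      rw [upd_self, List.mem_append] at hA
      rcases hA with hA | hA
      · exact Item.ok_mono (SP_mono hM) A (p.okl c A hA)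
      · exact hok A hA
    · have hA' : A ∈ p.l c := by simpa [upd, hc] using hA
      exact Item.ok_mono (SP_mono hM) A (p.okl c A hA')
  · intro c T x s hA hs
    have hA' : Item.mem T x s ∈ p.l c := by
      by_cases hc : c = b
      · subst hc
        rw [upd_self, List.mem_append] at hA
        rcases hA with hA | hA
        · exact hA
        · exact absurd hs (hmem T x s hA)
      · simpa [upd, hc] using hA
    exact (upd_ext p.l b As (!c)).subset (p.sync c T x s hA' hs)
  · intro A hA
    show A ∈ upd p.l b As b
    rw [upd_self]; exact List.mem_append_right _ hA

/-- Adding consequences. -/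
theorem ext_imp (p : St) (b : Bool) (As : List Item)
    (hok : ∀ A ∈ As, A.ok (SP p.Γ p.ρ p.N b))
    (hmem : ∀ T x s, Item.mem T x s ∈ As → s.1 ≠ none)
    (himp : ∀ (U : Type) (v : Val U), Holds v (p.l b) → Holds v As) :
    ∃ q : St, p ≤ q ∧ ∀ A ∈ As, A ∈ q.l b := by
  refine ext_side p b As p.N le_rfl hok hmem fun hs => p.insep ?_
  rw [sep_iff b] at hs ⊢
  obtain ⟨θ, h1, h2⟩ := hs
  rw [upd_self] at h1
  rw [upd_not] at h2
  exact ⟨θ, fun U v h => h1 U v ((holds_append v _ _).2 ⟨h, himp U v h⟩), h2⟩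

theorem ext_one (p : St) (b : Bool) (A : Item)
    (hok : A.ok (SP p.Γ p.ρ p.N b))
    (hmem : ∀ T x s, A ≠ Item.mem T x s)
    (himp : ∀ (U : Type) (v : Val U), Holds v (p.l b) → A.holds v) :
    ∃ q : St, p ≤ q ∧ A ∈ q.l b := by
  obtain ⟨q, hq, h⟩ := ext_imp p b [A] (by simpa using hok)
    (fun T x s h => absurd (List.mem_singleton.1 h).symm (hmem T x s))
    (fun U v h => by simpa [Holds] using himp U v h)
  exact ⟨q, hq, h A (by simp)⟩

theorem no_unsat (p : St) (b : Bool) : ∃ (U : Type) (v : Val U), Holds v (p.l b) := by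
  by_contra hc
  push Not at hc
  apply p.insep
  rw [sep_iff b]
  exact ⟨.fls, fun U v h => absurd h (hc U v), fun U v _ h => h⟩

theorem St.le_mem {p q : St} (h : p ≤ q) {b : Bool} {A : Item} (hA : A ∈ p.l b) : A ∈ q.l b :=
  (h b).subset hA

theorem step_or (p : St) (b : Bool) {Γ : List NTy} (φ ψ : D0 Γ) (ρ : VEnv Γ)
    (hA : Item.fml Γ (.or φ ψ) ρ ∈ p.l b) :
    ∃ q : St, p ≤ q ∧ (Item.fml Γ φ ρ ∈ q.l b ∨ Item.fml Γ ψ ρ ∈ q.l b) := by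
  have hok : okE (SP p.Γ p.ρ p.N b) ρ := p.okl b _ hA
  by_cases h1 : Sep p.Γ p.ρ (upd p.l b [Item.fml Γ φ ρ])
  · by_cases h2 : Sep p.Γ p.ρ (upd p.l b [Item.fml Γ ψ ρ])
    · exfalso
      apply p.insep
      rw [sep_iff b] at h1 h2 ⊢
      obtain ⟨θ1, h1, h1'⟩ := h1
      obtain ⟨θ2, h2, h2'⟩ := h2
      rw [upd_self] at h1 h2
      rw [upd_not] at h1' h2'
      refine ⟨.or θ1 θ2, fun U v h => ?_, fun U v h h' => ?_⟩
      · rcases h _ hA with h3 | h3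
        · left; exact h1 U v ((holds_append v _ _).2 ⟨h, by simpa [Holds, Item.holds] using h3⟩)
        · right; exact h2 U v ((holds_append v _ _).2 ⟨h, by simpa [Holds, Item.holds] using h3⟩)
      · rcases h' with h' | h'
        · exact h1' U v h h'
        · exact h2' U v h h'
    · obtain ⟨q, hq, h⟩ := ext_side p b [Item.fml Γ ψ ρ] p.N le_rfl (by simpa [Item.ok] using hok)
        (by simp) h2
      exact ⟨q, hq, Or.inr (h _ (by simp))⟩
  · obtain ⟨q, hq, h⟩ := ext_side p b [Item.fml Γ φ ρ] p.N le_rfl (by simpa [Item.ok] using hok)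
      (by simp) h1
    exact ⟨q, hq, Or.inl (h _ (by simp))⟩

theorem step_transfer (p : St) (b : Bool) (m n : Nm) (hA : Item.eq m n ∈ p.l b)
    (hm : m.1 = none) (hn : n.1 = none) : ∃ q : St, p ≤ q ∧ Item.eq m n ∈ q.l (!b) := by
  have hok : SP p.Γ p.ρ p.N b .ur m ∧ SP p.Γ p.ρ p.N b .ur n := p.okl b _ hA
  have dm : p.Γ.length = p.Γ.length ∧ Dfn p.Γ p.ρ .ur m := by
    rcases hok.1.2 with h | h
    · rw [hm] at h; cases h
    · exact ⟨rfl, h.2⟩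
  have dn : Dfn p.Γ p.ρ .ur n := by
    rcases hok.2.2 with h | h
    · rw [hn] at h; cases h
    · exact h.2
  obtain ⟨q, hq, h⟩ := ext_side p (!b) [Item.eq m n] p.N le_rfl
    (by
      intro A hA'
      rw [List.mem_singleton.1 hA']
      exact ⟨⟨hok.1.1, Or.inr ⟨hm, dm.2⟩⟩, ⟨hok.2.1, Or.inr ⟨hn, dn⟩⟩⟩)
    (by simp)
    (by
      intro hs
      apply p.insep
      rw [sep_iff b] at hs ⊢
      obtain ⟨θ, h1, h2⟩ := hs
      rw [upd_self] at h2
      have e : upd p.l (!b) [Item.eq m n] b = p.l b := by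
        have := upd_not p.l (!b) [Item.eq m n]
        rwa [Bool.not_not] at this
      rw [e] at h1
      obtain ⟨t1, e1⟩ := dm.2
      obtain ⟨t2, e2⟩ := dn
      have key : ∀ (U : Type) (v : Val U),
          (D0.eq t1 t2).Sat (v.env p.ρ) ↔ (Item.eq m n).holds v := by
        intro U v
        simp only [D0.Sat, eval_env, e1, e2]
        rfl
      refine ⟨.and θ (.eq t1 t2), fun U v h => ⟨h1 U v h, (key U v).2 (h _ hA)⟩, ?_⟩
      rintro U v h ⟨h3, h4⟩
      refine h2 U v ((holds_append v _ _).2 ⟨h, ?_⟩) h3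
      intro A hA'
      rw [List.mem_singleton.1 hA']
      exact (key U v).1 h4)
  exact ⟨q, hq, h _ (by simp)⟩

theorem step_ex (p : St) (b : Bool) {Γ : List NTy} {T : NTy} (t : Tm Γ (.set T))
    (φ : D0 (T :: Γ)) (ρ : VEnv Γ) (hA : Item.fml Γ (.ex t φ) ρ ∈ p.l b) :
    ∃ q : St, p ≤ q ∧ ∃ x : V T, Item.mem T x (evalV ρ t) ∈ q.l b ∧
      Item.fml (T :: Γ) φ (VEnv.cons x ρ) ∈ q.l b := by
  have hok : okE (SP p.Γ p.ρ p.N b) ρ := p.okl b _ hA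
  have hs : SP p.Γ p.ρ p.N b (.set T) (evalV ρ t) := ok_evalV ρ hok t
  -- behaviour of updates
  have upd_ok : ∀ (x : V T) (U : Type) (v w : Val U) (y : NObj U T), w.app T x = y →
      Agree (fun _ n => n.2 < p.N) v w →
      (∀ c, Holds v (p.l c) → Holds w (p.l c)) ∧ v.env p.ρ = w.env p.ρ ∧
      v.env ρ = w.env ρ ∧ v.s T (evalV ρ t) = w.s T (evalV ρ t) := by
    intro x U v w y _ hag
    refine ⟨fun c h A hA' => ?_, env_agree hag _ p.okr,
      env_agree hag _ (okE_mono (fun _ n h => h.1) _ hok), hag.2 T _ hs.1⟩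
    exact Item.holds_agree hag A (Item.ok_mono (fun _ n h => h.1) A (p.okl c A hA')) (h A hA')
  have wit : ∀ (x : V T), (∀ (U : Type) (v : Val U) (y : NObj U T), ∃ w : Val U,
      w.app T x = y ∧ Agree (fun _ n => n.2 < p.N) v w) →
      ∀ (U : Type) (v : Val U), Holds v (p.l b) → ∃ w : Val U, Holds w (p.l b) ∧
        Holds w [Item.mem T x (evalV ρ t), Item.fml (T :: Γ) φ (VEnv.cons x ρ)] ∧
        v.env p.ρ = w.env p.ρ ∧ w.app T x ∈ v.s T (evalV ρ t) := by
    intro x hx U v h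
    have h0 : (D0.ex t φ).Sat (v.env ρ) := h _ hA
    obtain ⟨y, hy, hφ⟩ := h0
    rw [eval_env] at hy
    have hy' : y ∈ v.s T (evalV ρ t) := hy
    obtain ⟨w, e, hag⟩ := hx U v y
    obtain ⟨a1, a2, a3, a4⟩ := upd_ok x U v w y e hag
    refine ⟨w, a1 b h, ?_, a2, by rw [e]; exact hy'⟩
    intro A hA'
    rcases List.mem_cons.1 hA' with rfl | hA'
    · show w.app T x ∈ w.s T (evalV ρ t)
      rw [e, ← a4]; exact hy'
    · rw [List.mem_singleton.1 hA']
      show φ.Sat (w.env (VEnv.cons x ρ))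
      rw [env_cons, e, ← a3]; exact hφ
  rcases hs.2 with hc | ⟨hc, hd⟩
  · -- private set name
    obtain ⟨x, M, hM, okx, hx⟩ := fresh T (some b) p.N
    have okx' : ok (SP p.Γ p.ρ M b) T x := ok_mono (fun _ n h => ⟨h.2, Or.inl h.1⟩) _ _ okx
    obtain ⟨q, hq, h⟩ := ext_side p b
      [Item.mem T x (evalV ρ t), Item.fml (T :: Γ) φ (VEnv.cons x ρ)] M hM
      (by
        intro A hA'
        rcases List.mem_cons.1 hA' with rfl | hA'
        · exact ⟨okx', SP_mono hM _ _ hs⟩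
        · rw [List.mem_singleton.1 hA']
          exact okE_cons x ρ okx' (okE_mono (SP_mono hM) _ hok))
      (by
        intro T' x' s' h'
        rcases List.mem_cons.1 h' with h' | h'
        · injection h' with _ _ e
          rw [e, hc]; simp
        · simp at h')
      (by
        intro hsep
        apply p.insep
        rw [sep_iff b] at hsep ⊢
        obtain ⟨θ, h1, h2⟩ := hsep
        rw [upd_self] at h1
        rw [upd_not] at h2
        refine ⟨θ, fun U v h => ?_, h2⟩
        obtain ⟨w, w1, w2, w3, _⟩ := wit x hx U v h
        rw [w3]
        exact h1 U w ((holds_append w _ _).2 ⟨w1, w2⟩))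
    exact ⟨q, hq, x, h _ (by simp), h _ (by simp)⟩
  · -- shared set name
    obtain ⟨t', et'⟩ := hd
    obtain ⟨x, M, hM, okx, hx⟩ := fresh T none p.N
    have okx' : ∀ c, ok (SP (T :: p.Γ) (VEnv.cons x p.ρ) M c) T x := by
      intro c
      have := ok_and T x okx (ok_dfn (VEnv.cons x p.ρ) T (v0 T))
      exact ok_mono (fun _ n h => ⟨h.1.2, Or.inr ⟨h.1.1, h.2⟩⟩) _ _ this
    have mono' : ∀ c T' n, SP p.Γ p.ρ p.N c T' n →
        SP (T :: p.Γ) (VEnv.cons x p.ρ) M c T' n := by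
      intro c T' n h
      exact ⟨h.1.trans_le hM, h.2.imp id fun h => ⟨h.1, dfn_wk p.ρ x T' n h.2⟩⟩
    have hs' : ∀ c, SP (T :: p.Γ) (VEnv.cons x p.ρ) M c (.set T) (evalV ρ t) := fun c =>
      ⟨hs.1.trans_le hM, Or.inr ⟨hc, dfn_wk p.ρ x (.set T) _ ⟨t', et'⟩⟩⟩
    let l' := upd (upd p.l b [Item.mem T x (evalV ρ t), Item.fml (T :: Γ) φ (VEnv.cons x ρ)])
      (!b) [Item.mem T x (evalV ρ t)]
    have lb : l' b = p.l b ++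
        [Item.mem T x (evalV ρ t), Item.fml (T :: Γ) φ (VEnv.cons x ρ)] := by
      have := upd_not (upd p.l b [Item.mem T x (evalV ρ t),
        Item.fml (T :: Γ) φ (VEnv.cons x ρ)]) (!b) [Item.mem T x (evalV ρ t)]
      rw [Bool.not_not, upd_self] at this
      exact this
    have lnb : l' (!b) = p.l (!b) ++ [Item.mem T x (evalV ρ t)] := by
      show upd _ _ _ _ = _
      rw [upd_self, upd_not]
    have cases_b : ∀ c : Bool, c = b ∨ c = !b := by
      intro c; cases c <;> cases b <;> simp
    have hpre : ∀ c, p.l c <+: l' c := fun c => (upd_ext _ _ _ _).trans (upd_ext _ _ _ _)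
    have memnew : ∀ c, Item.mem T x (evalV ρ t) ∈ l' c := by
      intro c
      rcases cases_b c with rfl | rfl
      · rw [lb]; simp
      · rw [lnb]; simp
    refine ⟨⟨T :: p.Γ, VEnv.cons x p.ρ, l', M, ?_, ?_, ?_, ?_⟩, hpre, x, memnew b, ?_⟩
    · exact okE_cons x p.ρ (ok_mono (fun _ n h => h.2) _ _ okx)
        (okE_mono (fun _ n h => lt_of_lt_of_le h hM) _ p.okr)
    · intro c A hA'
      have : A ∈ p.l c ∨ A = Item.mem T x (evalV ρ t) ∨
          (A = Item.fml (T :: Γ) φ (VEnv.cons x ρ) ∧ c = b) := by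
        rcases cases_b c with rfl | rfl
        · rw [lb] at hA'; simpa using hA'
        · rw [lnb] at hA'
          rcases List.mem_append.1 hA' with h | h
          · exact Or.inl h
          · exact Or.inr (Or.inl (List.mem_singleton.1 h))
      rcases this with h | rfl | ⟨rfl, rfl⟩
      · exact Item.ok_mono (mono' c) A (p.okl c A h)
      · exact ⟨okx' c, hs' c⟩
      · exact okE_cons x ρ (okx' c) (okE_mono (mono' c) _ hok)
    · intro c T' x' s' hA' hs0
      have : Item.mem T' x' s' ∈ p.l c ∨ Item.mem T' x' s' = Item.mem T x (evalV ρ t) := by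
        rcases cases_b c with rfl | rfl
        · rw [lb] at hA'
          rcases List.mem_append.1 hA' with h | h
          · exact Or.inl h
          · rcases List.mem_cons.1 h with h | h
            · exact Or.inr h
            · simp at h
        · rw [lnb] at hA'
          rcases List.mem_append.1 hA' with h | h
          · exact Or.inl h
          · exact Or.inr (List.mem_singleton.1 h)
      rcases this with h | h
      · exact (hpre (!c)).subset (p.sync c T' x' s' h hs0)
      · rw [h]; exact memnew (!c)
    · intro hsep
      apply p.insep
      rw [sep_iff b] at hsep ⊢
      obtain ⟨θ, h1, h2⟩ := hsep
      rw [lb] at h1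
      rw [lnb] at h2
      have key : ∀ (U : Type) (v : Val U),
          (t'.eval (v.env p.ρ)).asSet = v.s T (evalV ρ t) := by
        intro U v
        rw [eval_env, et']; rfl
      refine ⟨.ex t' θ, fun U v h => ?_, ?_⟩
      · obtain ⟨w, w1, w2, w3, w4⟩ := wit x hx U v h
        refine ⟨w.app T x, by rw [key]; exact w4, ?_⟩
        have := h1 U w ((holds_append w _ _).2 ⟨w1, w2⟩)
        rwa [env_cons, ← w3] at this
      · rintro U v h ⟨y, hy, hθ⟩
        rw [key] at hy
        obtain ⟨w, e, hag⟩ := hx U v y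
        obtain ⟨a1, a2, a3, a4⟩ := upd_ok x U v w y e hag
        refine h2 U w ((holds_append w _ _).2 ⟨a1 _ h, ?_⟩) ?_
        · intro A hA'
          rw [List.mem_singleton.1 hA']
          show w.app T x ∈ w.s T (evalV ρ t)
          rw [e, ← a4]; exact hy
        · rw [env_cons, e, ← a2]; exact hθ
    · show _ ∈ l' b
      rw [lb]; simp

/-! ### Treated requirements -/

def Treated (l : Bool → List Item) (b : Bool) : Item → Item → Prop
  | .fml Γ (.and φ ψ) ρ, _ => Item.fml Γ φ ρ ∈ l b ∧ Item.fml Γ ψ ρ ∈ l b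
  | .fml Γ (.or φ ψ) ρ, _ => Item.fml Γ φ ρ ∈ l b ∨ Item.fml Γ ψ ρ ∈ l b
  | .fml _ (.eq s t) ρ, _ => Item.eq (evalV ρ s) (evalV ρ t) ∈ l b
  | .fml Γ (@D0.ex _ T t φ) ρ, _ => ∃ x : V T, Item.mem T x (evalV ρ t) ∈ l b ∧
      Item.fml (T :: Γ) φ (VEnv.cons x ρ) ∈ l b
  | .fml Γ (@D0.all _ T t φ) ρ, B => ∀ x : V T, B = Item.mem T x (evalV ρ t) →
      Item.fml (T :: Γ) φ (VEnv.cons x ρ) ∈ l b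
  | .eq m n, B => Item.eq n m ∈ l b ∧ (∀ k, B = Item.eq n k → Item.eq m k ∈ l b) ∧
      (m.1 = none → n.1 = none → Item.eq m n ∈ l (!b))
  | _, _ => True

theorem step (p : St) (b : Bool) (A B : Item) (hA : A ∈ p.l b) (hB : B ∈ p.l b) :
    ∃ q : St, p ≤ q ∧ Treated q.l b A B := by
  cases A with
  | mem T x s => exact ⟨p, le_rfl, trivial⟩
  | eq m n =>
    have ok1 : SP p.Γ p.ρ p.N b .ur m ∧ SP p.Γ p.ρ p.N b .ur n := p.okl b _ hA
    obtain ⟨q1, hq1, h1⟩ := ext_one p b (.eq n m) ⟨ok1.2, ok1.1⟩ (by simp)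
      (fun U v h => (h _ hA : v.u m = v.u n).symm)
    have s2 : ∃ q2 : St, q1 ≤ q2 ∧ ∀ k, B = Item.eq n k → Item.eq m k ∈ q2.l b := by
      by_cases hk : ∃ k, B = Item.eq n k
      · obtain ⟨k, rfl⟩ := hk
        have hA1 := St.le_mem hq1 hA
        have hB1 := St.le_mem hq1 hB
        have o1 : SP q1.Γ q1.ρ q1.N b .ur m ∧ SP q1.Γ q1.ρ q1.N b .ur n := q1.okl b _ hA1
        have o2 : SP q1.Γ q1.ρ q1.N b .ur n ∧ SP q1.Γ q1.ρ q1.N b .ur k := q1.okl b _ hB1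
        obtain ⟨q2, hq2, h2⟩ := ext_one q1 b (.eq m k) ⟨o1.1, o2.2⟩ (by simp)
          (fun U v h => (h _ hA1 : v.u m = v.u n).trans (h _ hB1 : v.u n = v.u k))
        refine ⟨q2, hq2, fun k' e => ?_⟩
        injection e with _ e
        rw [← e]; exact h2
      · exact ⟨q1, le_rfl, fun k e => absurd ⟨k, e⟩ hk⟩
    obtain ⟨q2, hq2, h2⟩ := s2
    have s3 : ∃ q3 : St, q2 ≤ q3 ∧ (m.1 = none → n.1 = none → Item.eq m n ∈ q3.l (!b)) := by
      by_cases hmn : m.1 = none ∧ n.1 = none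
      · obtain ⟨q3, hq3, h3⟩ := step_transfer q2 b m n (St.le_mem (hq1.trans hq2) hA) hmn.1 hmn.2
        exact ⟨q3, hq3, fun _ _ => h3⟩
      · exact ⟨q2, le_rfl, fun a b => absurd ⟨a, b⟩ hmn⟩
    obtain ⟨q3, hq3, h3⟩ := s3
    exact ⟨q3, (hq1.trans hq2).trans hq3, St.le_mem (hq2.trans hq3) h1,
      fun k e => St.le_mem hq3 (h2 k e), h3⟩
  | fml Γ φ ρ =>
    have hok : okE (SP p.Γ p.ρ p.N b) ρ := p.okl b _ hA
    cases φ with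
    | eq s t =>
      exact ext_one p b (.eq (evalV ρ s) (evalV ρ t)) ⟨ok_evalV ρ hok s, ok_evalV ρ hok t⟩
        (by simp) (fun U v h => by
          have h0 : (D0.eq s t).Sat (v.env ρ) := h _ hA
          simp only [D0.Sat, eval_env] at h0
          exact h0)
    | ne s t => exact ⟨p, le_rfl, trivial⟩
    | tru => exact ⟨p, le_rfl, trivial⟩
    | fls => exact ⟨p, le_rfl, trivial⟩
    | and φ ψ =>
      obtain ⟨q, hq, h⟩ := ext_imp p b [.fml Γ φ ρ, .fml Γ ψ ρ]
        (by
          intro A hA'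
          rcases List.mem_cons.1 hA' with rfl | hA'
          · exact hok
          · rw [List.mem_singleton.1 hA']; exact hok)
        (by simp)
        (by
          intro U v h A hA'
          have h0 : φ.Sat (v.env ρ) ∧ ψ.Sat (v.env ρ) := h _ hA
          rcases List.mem_cons.1 hA' with rfl | hA'
          · exact h0.1
          · rw [List.mem_singleton.1 hA']; exact h0.2)
      exact ⟨q, hq, h _ (by simp), h _ (by simp)⟩
    | or φ ψ => exact step_or p b φ ψ ρ hA
    | @all _ T t φ =>
      by_cases hx : ∃ x : V T, B = Item.mem T x (evalV ρ t)
      · obtain ⟨x, rfl⟩ := hx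
        have o2 : ok (SP p.Γ p.ρ p.N b) T x ∧ _ := p.okl b _ hB
        obtain ⟨q, hq, h⟩ := ext_one p b (.fml (T :: Γ) φ (VEnv.cons x ρ))
          (okE_cons x ρ o2.1 hok) (by simp)
          (fun U v h => by
            have h0 : (D0.all t φ).Sat (v.env ρ) := h _ hA
            have h1 : v.app T x ∈ v.s T (evalV ρ t) := h _ hB
            have h2 := h0 (v.app T x) (by rw [eval_env]; exact h1)
            rw [← env_cons] at h2
            exact h2)
        refine ⟨q, hq, fun x' e => ?_⟩
        have : x = x' := by
          injection e with _ e
        rw [← this]; exact h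
      · exact ⟨p, le_rfl, fun x e => absurd ⟨x, e⟩ hx⟩
    | ex t φ => exact step_ex p b t φ ρ hA

theorem treated_mono {p q : St} (h : p ≤ q) (b : Bool) (A B : Item)
    (ht : Treated p.l b A B) : Treated q.l b A B := by
  cases A with
  | mem T x s => trivial
  | eq m n => exact ⟨St.le_mem h ht.1, fun k e => St.le_mem h (ht.2.1 k e),
      fun a c => St.le_mem h (ht.2.2 a c)⟩
  | fml Γ φ ρ =>
    cases φ with
    | eq s t => exact St.le_mem h ht
    | ne s t => trivial
    | tru => trivial
    | fls => trivial
    | and φ ψ => exact ⟨St.le_mem h ht.1, St.le_mem h ht.2⟩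
    | or φ ψ => exact ht.imp (St.le_mem h) (St.le_mem h)
    | all t φ => exact fun x e => St.le_mem h (ht x e)
    | ex t φ =>
      obtain ⟨x, h1, h2⟩ := ht
      exact ⟨x, St.le_mem h h1, St.le_mem h h2⟩

theorem pad (p : St) (b : Bool) (k : ℕ) : ∃ q : St, p ≤ q ∧ k < (q.l b).length := by
  have hpad : ∀ A ∈ List.replicate (k + 1) (Item.fml [] .tru VEnv.nil),
      A = Item.fml [] .tru VEnv.nil := fun A hA => List.eq_of_mem_replicate hA
  refine ⟨⟨p.Γ, p.ρ, upd p.l b (List.replicate (k + 1) (Item.fml [] .tru VEnv.nil)), p.N, p.okr,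
    ?_, ?_, ?_⟩, fun c => upd_ext _ _ _ _, ?_⟩
  · intro c A hA
    have : A ∈ p.l c ∨ A = Item.fml [] .tru VEnv.nil := by
      unfold upd at hA
      split_ifs at hA
      · exact (List.mem_append.1 hA).imp id (hpad A)
      · exact Or.inl hA
    rcases this with h | rfl
    · exact p.okl c A h
    · exact okE_nil
  · intro c T x s hA hs
    have : Item.mem T x s ∈ p.l c := by
      unfold upd at hA
      split_ifs at hA
      · rcases List.mem_append.1 hA with h | h
        · exact h
        · exact absurd (hpad _ h) (by simp)
      · exact hA
    exact (upd_ext _ _ _ _).subset (p.sync c T x s this hs)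
  · intro hs
    apply p.insep
    rw [sep_iff b] at hs ⊢
    obtain ⟨θ, h1, h2⟩ := hs
    rw [upd_self] at h1
    rw [upd_not] at h2
    refine ⟨θ, fun U v h => h1 U v ((holds_append v _ _).2 ⟨h, ?_⟩), h2⟩
    intro A hA
    rw [hpad A hA]
    trivial
  · show k < (upd p.l b _ b).length
    rw [upd_self, List.length_append, List.length_replicate]
    omega

theorem prefix_some {l m : List Item} (h : l <+: m) {j : ℕ} {A : Item}
    (hA : l[j]? = some A) : m[j]? = some A := by
  obtain ⟨r, rfl⟩ := h
  rw [List.getElem?_append_left (List.getElem?_eq_some_iff.1 hA).1, hA]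

def Dns (i : Bool × ℕ × ℕ) : Order.Cofinal St where
  carrier := {p | ∃ A B, (p.l i.1)[i.2.1]? = some A ∧ (p.l i.1)[i.2.2]? = some B ∧
    Treated p.l i.1 A B}
  isCofinal := by
    obtain ⟨b, j, k⟩ := i
    intro p
    obtain ⟨q, hq, hl⟩ := pad p b (max j k)
    have hj : j < (q.l b).length := (le_max_left _ _).trans_lt hl
    have hk : k < (q.l b).length := (le_max_right _ _).trans_lt hl
    obtain ⟨r, hr, ht⟩ := step q b _ _ (List.getElem_mem hj) (List.getElem_mem hk)
    refine ⟨r, ⟨(q.l b)[j], (q.l b)[k], ?_, ?_, ht⟩, hq.trans hr⟩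
    · exact prefix_some (hr b) (List.getElem?_eq_getElem hj)
    · exact prefix_some (hr b) (List.getElem?_eq_getElem hk)

/-- The limit of a generic sequence of states. -/
theorem exists_limit (p : St) : ∃ L : Bool → Set Item,
    (∀ b, ∀ A ∈ p.l b, A ∈ L b) ∧
    (∀ b A B, A ∈ L b → B ∈ L b → ∃ q : St, (∀ c, ∀ C ∈ q.l c, C ∈ L c) ∧
      A ∈ q.l b ∧ B ∈ q.l b ∧ Treated q.l b A B) := by
  classical
  let G := Order.idealOfCofinals p Dns
  refine ⟨fun b => {A | ∃ q ∈ G, A ∈ q.l b}, fun b A hA =>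
    ⟨p, Order.mem_idealOfCofinals p Dns, hA⟩, ?_⟩
  rintro b A B ⟨q1, hq1, h1⟩ ⟨q2, hq2, h2⟩
  obtain ⟨j, hj⟩ := List.getElem?_of_mem h1
  obtain ⟨k, hk⟩ := List.getElem?_of_mem h2
  obtain ⟨q3, ⟨A', B', hA', hB', ht⟩, hq3⟩ := Order.cofinal_meets_idealOfCofinals p Dns (b, j, k)
  obtain ⟨r, hr, h1r, h2r⟩ := G.directed q1 hq1 q2 hq2
  obtain ⟨r', hr', hrr, h3r⟩ := G.directed r hr q3 hq3
  have e1 : A = A' := by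
    have a := prefix_some ((h1r.trans hrr) b) hj
    have b' := prefix_some (h3r b) hA'
    exact Option.some.inj (a.symm.trans b')
  have e2 : B = B' := by
    have a := prefix_some ((h2r.trans hrr) b) hk
    have b' := prefix_some (h3r b) hB'
    exact Option.some.inj (a.symm.trans b')
  subst e1 e2
  exact ⟨r', fun c C hC => ⟨r', hr', hC⟩, St.le_mem (h1r.trans hrr) h1,
    St.le_mem (h2r.trans hrr) h2, treated_mono h3r b _ _ ht⟩


/-! ### The canonical model -/

section model

variable {L : Bool → Set Item}

/-- Interpretation of names in the canonical model. -/
def capp (L : Bool → Set Item) (f : Nm → Nm) : ∀ T, V T → NObj Nm T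
  | .ur => f
  | .unit => fun _ => ()
  | .prod a b => fun x => (capp L f a x.1, capp L f b x.2)
  | .set a => fun n => ({y | ∃ x : V a, (∃ b, Item.mem a x n ∈ L b) ∧ capp L f a x = y} :
      Set (NObj Nm a))

def cval (L : Bool → Set Item) (f : Nm → Nm) : Val Nm where
  u := f
  s := fun T n => capp L f (.set T) n

theorem cval_app (f : Nm → Nm) (T : NTy) : ∀ x : V T, (cval L f).app T x = capp L f T x := by
  induction T with
  | ur => intro x; rfl
  | unit => intro x; rfl
  | prod a b h1 h2 => intro x; exact Prod.ext (h1 _) (h2 _)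
  | set a _ => intro x; rfl

def EqL (L : Bool → Set Item) (b : Bool) (m n : Nm) : Prop := m = n ∨ Item.eq m n ∈ L b

/-- Amalgamating the two equality relations. -/
theorem exists_rep
    (hsym : ∀ b m n, Item.eq m n ∈ L b → Item.eq n m ∈ L b)
    (htr : ∀ b m n k, Item.eq m n ∈ L b → Item.eq n k ∈ L b → Item.eq m k ∈ L b)
    (hsh : ∀ b m n, Item.eq m n ∈ L b → m.1 = none → n.1 = none → Item.eq m n ∈ L (!b)) :
    ∃ f : Nm → Nm, ∀ b m n, (m.1 = some b ∨ m.1 = none) → (n.1 = some b ∨ n.1 = none) →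
      (f m = f n ↔ EqL L b m n) := by
  classical
  let S : Bool → Setoid Nm := fun b =>
    { r := EqL L b
      iseqv :=
        { refl := fun m => Or.inl rfl
          symm := fun {m n} h => h.elim (fun e => Or.inl e.symm) (fun h => Or.inr (hsym b m n h))
          trans := by
            intro m n k h1 h2
            rcases h1 with rfl | h1
            · exact h2
            · rcases h2 with rfl | h2
              · exact Or.inr h1
              · exact Or.inr (htr b m n k h1 h2) } }
  let K : Bool → Nm → Set ℕ := fun b m => {k | EqL L b m (none, k)}
  let g : Bool → Nm → Nm := fun b m =>
    if (K b m).Nonempty then (none, sInf (K b m)) else (Quotient.mk (S b) m).out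
  have g1 : ∀ b m n, EqL L b m n → g b m = g b n := by
    intro b m n h
    have e : K b m = K b n := by
      ext k
      exact ⟨fun h' => (S b).trans ((S b).symm h) h', fun h' => (S b).trans h h'⟩
    have e' : Quotient.mk (S b) m = Quotient.mk (S b) n := Quotient.sound (s := S b) h
    simp only [g, e, e']
  have g2 : ∀ b m, EqL L b m (g b m) := by
    intro b m
    by_cases h : (K b m).Nonempty
    · have e : g b m = (none, sInf (K b m)) := if_pos h
      rw [e]
      exact Nat.sInf_mem h
    · have e : g b m = (Quotient.mk (S b) m).out := if_neg h
      rw [e]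
      exact (S b).symm (Quotient.exact (s := S b) (Quotient.out_eq (Quotient.mk (S b) m)))
  have hKn : ∀ b c m, m.1 = none → K b m ⊆ K c m := by
    intro b c m hm k hk
    by_cases hbc : c = b
    · rw [hbc]; exact hk
    · have : c = !b := by cases b <;> cases c <;> simp_all
      rw [this]
      rcases hk with hk | hk
      · exact Or.inl hk
      · exact Or.inr (hsh b _ _ hk hm rfl)
  have g3 : ∀ b c m, m.1 = none → g b m = g c m := by
    intro b c m hm
    have e : K b m = K c m := Set.Subset.antisymm (hKn b c m hm) (hKn c b m hm)
    have ne : (K c m).Nonempty := ⟨m.2, Or.inl (Prod.ext hm rfl)⟩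
    simp only [g, e, if_pos ne]
  have key : ∀ b m, (m.1 = some b ∨ m.1 = none) → g (m.1.getD true) m = g b m := by
    intro b m h
    rcases h with h | h
    · rw [h]; rfl
    · exact g3 _ _ m h
  refine ⟨fun m => g (m.1.getD true) m, fun b m n hm hn => ?_⟩
  show g (m.1.getD true) m = g (n.1.getD true) n ↔ _
  rw [key b m hm, key b n hn]
  exact ⟨fun e => (S b).trans (g2 b m) (by rw [e]; exact (S b).symm (g2 b n)), g1 b m n⟩

end model

theorem exists_model (p : St) : ∃ (U : Type) (v : Val U), ∀ b, Holds v (p.l b) := by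
  obtain ⟨L, hL, hT⟩ := exists_limit p
  obtain ⟨f, hf⟩ := exists_rep (L := L)
    (by
      intro b m n h
      obtain ⟨q, hq, _, _, ht⟩ := hT b _ _ h h
      exact hq _ _ ht.1)
    (by
      intro b m n k h h'
      obtain ⟨q, hq, _, _, ht⟩ := hT b _ _ h h'
      exact hq _ _ (ht.2.1 k rfl))
    (by
      intro b m n h hm hn
      obtain ⟨q, hq, _, _, ht⟩ := hT b _ _ h h
      exact hq _ _ (ht.2.2 hm hn))
  have color : ∀ b A, A ∈ L b → A.ok (fun _ n => n.1 = some b ∨ n.1 = none) := by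
    intro b A hA
    obtain ⟨q, hq, h1, _, _⟩ := hT b _ _ hA hA
    exact Item.ok_mono (fun _ n h => h.2.imp id fun h => h.1) A (q.okl b A h1)
  have heq : ∀ b m n, Item.eq m n ∈ L b → f m = f n := by
    intro b m n h
    have c := color b _ h
    exact (hf b m n c.1 c.2).2 (Or.inr h)
  have truth : ∀ {Γ : List NTy} (φ : D0 Γ) (ρ : VEnv Γ) (b : Bool), Item.fml Γ φ ρ ∈ L b →
      φ.Sat ((cval L f).env ρ) := by
    intro Γ φ
    induction φ with
    | eq s t =>
      intro ρ b h
      obtain ⟨q, hq, _, _, ht⟩ := hT b _ _ h h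
      simp only [D0.Sat, eval_env]
      exact heq b _ _ (hq _ _ ht)
    | ne s t =>
      intro ρ b h
      simp only [D0.Sat, eval_env]
      intro e
      have c : okE (fun _ n => n.1 = some b ∨ n.1 = none) ρ := color b _ h
      have e' : f (evalV ρ s) = f (evalV ρ t) := e
      have hE := (hf b _ _ (ok_evalV ρ c s) (ok_evalV ρ c t)).1 e'
      have : ∃ q : St, Item.fml _ (.ne s t) ρ ∈ q.l b ∧
          (evalV ρ s = evalV ρ t ∨ Item.eq (evalV ρ s) (evalV ρ t) ∈ q.l b) := by
        rcases hE with hE | hE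
        · obtain ⟨q, _, h1, _, _⟩ := hT b _ _ h h
          exact ⟨q, h1, Or.inl hE⟩
        · obtain ⟨q, _, h1, h2, _⟩ := hT b _ _ h hE
          exact ⟨q, h1, Or.inr h2⟩
      obtain ⟨q, h1, h2⟩ := this
      obtain ⟨U, v, hv⟩ := no_unsat q b
      have h3 : (D0.ne s t).Sat (v.env ρ) := hv _ h1
      simp only [D0.Sat, eval_env] at h3
      rcases h2 with h2 | h2
      · exact h3 (by rw [h2])
      · exact h3 (hv _ h2)
    | tru => intro ρ b h; simp only [D0.Sat]
    | fls =>
      intro ρ b h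
      obtain ⟨q, _, h1, _, _⟩ := hT b _ _ h h
      obtain ⟨U, v, hv⟩ := no_unsat q b
      have h3 : (D0.fls).Sat (v.env ρ) := hv _ h1
      simp only [D0.Sat] at h3
    | and φ ψ h1 h2 =>
      intro ρ b h
      obtain ⟨q, hq, _, _, ht⟩ := hT b _ _ h h
      simp only [D0.Sat]
      exact ⟨h1 ρ b (hq _ _ ht.1), h2 ρ b (hq _ _ ht.2)⟩
    | or φ ψ h1 h2 =>
      intro ρ b h
      obtain ⟨q, hq, _, _, ht⟩ := hT b _ _ h h
      simp only [D0.Sat]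
      exact ht.imp (fun ht => h1 ρ b (hq _ _ ht)) (fun ht => h2 ρ b (hq _ _ ht))
    | @all Γ T t φ ih =>
      intro ρ b h
      simp only [D0.Sat, eval_env]
      rintro y ⟨x, ⟨c, hx⟩, rfl⟩
      have hxb : Item.mem T x (evalV ρ t) ∈ L b := by
        by_cases hcb : c = b
        · rw [← hcb]; exact hx
        · have hb : b = !c := by cases b <;> cases c <;> simp_all
          have c1 : okE (fun _ n => n.1 = some b ∨ n.1 = none) ρ := color b _ h
          have c2 := ok_evalV ρ c1 t
          have c2' : Prod.fst (evalV ρ t : Nm) = some b ∨ Prod.fst (evalV ρ t : Nm) = none := c2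
          have c3 : Prod.fst (evalV ρ t : Nm) = some c ∨ Prod.fst (evalV ρ t : Nm) = none :=
            (color c _ hx).2
          have hn : Prod.fst (evalV ρ t : Nm) = none := by
            rcases c2' with c2' | c2'
            · rcases c3 with c3 | c3
              · rw [c2'] at c3
                exact absurd (Option.some.inj c3).symm hcb
              · exact c3
            · exact c2'
          obtain ⟨q, hq, h1, _, _⟩ := hT c _ _ hx hx
          rw [hb]
          exact hq _ _ (q.sync c T x _ h1 hn)
      obtain ⟨q, hq, _, _, ht⟩ := hT b _ _ h hxb
      have := ih (VEnv.cons x ρ) b (hq _ _ (ht x rfl))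
      rwa [env_cons, cval_app] at this
    | @ex Γ T t φ ih =>
      intro ρ b h
      obtain ⟨q, hq, _, _, x, h1, h2⟩ := hT b _ _ h h
      simp only [D0.Sat, eval_env]
      refine ⟨capp L f T x, ⟨x, ⟨b, hq _ _ h1⟩, rfl⟩, ?_⟩
      have := ih (VEnv.cons x ρ) b (hq _ _ h2)
      rwa [env_cons, cval_app] at this
  refine ⟨Nm, cval L f, fun b A hA => ?_⟩
  have hA' := hL b A hA
  cases A with
  | fml Γ φ ρ => exact truth φ ρ b hA'
  | mem T x s => exact ⟨x, ⟨b, hA'⟩, (cval_app f T x).symm⟩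
  | eq m n => exact heq b m n hA'

/-! ### Interpolation in the form needed -/

def mk2 {U : Type} {Ti To : NTy} (i : NObj U Ti) (o : NObj U To) : Env U [Ti, To] :=
  Env.cons i (Env.cons o Env.nil)

theorem interp {Ti Ta To Tp : NTy} (φ : D0 [Ti, Ta, To]) (χ : D0 [Ti, To, Tp])
    (h : ∀ (U : Type) [Nonempty U] (i : NObj U Ti) (a : NObj U Ta) (o : NObj U To)
      (p : NObj U Tp), φ.Sat (mk3 i a o) → ¬ χ.Sat (mk3 i o p)) :
    ∃ θ : D0 [Ti, To],
      (∀ (U : Type) [Nonempty U] (i : NObj U Ti) (a : NObj U Ta) (o : NObj U To),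
        φ.Sat (mk3 i a o) → θ.Sat (mk2 i o)) ∧
      (∀ (U : Type) [Nonempty U] (i : NObj U Ti) (o : NObj U To) (p : NObj U Tp),
        χ.Sat (mk3 i o p) → ¬ θ.Sat (mk2 i o)) := by
  obtain ⟨xi, M1, hM1, ok1, f1⟩ := fresh Ti none 0
  obtain ⟨xo, M2, hM2, ok2, f2⟩ := fresh To none M1
  obtain ⟨xa, M3, hM3, ok3, f3⟩ := fresh Ta (some true) M2
  obtain ⟨xp, M4, hM4, ok4, f4⟩ := fresh Tp (some false) M2
  let ρ : VEnv [Ti, To] := VEnv.cons xi (VEnv.cons xo VEnv.nil)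
  let ρL : VEnv [Ti, Ta, To] := VEnv.cons xi (VEnv.cons xa (VEnv.cons xo VEnv.nil))
  let ρR : VEnv [Ti, To, Tp] := VEnv.cons xi (VEnv.cons xo (VEnv.cons xp VEnv.nil))
  let l : Bool → List Item := fun b => if b then [.fml _ φ ρL] else [.fml _ χ ρR]
  have eL : ∀ (U : Type) (v : Val U), v.env ρL = mk3 (v.app _ xi) (v.app _ xa) (v.app _ xo) := by
    intro U v; simp only [ρL, env_cons, env_nil, mk3]
  have eR : ∀ (U : Type) (v : Val U), v.env ρR = mk3 (v.app _ xi) (v.app _ xo) (v.app _ xp) := by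
    intro U v; simp only [ρR, env_cons, env_nil, mk3]
  have eC : ∀ (U : Type) (v : Val U), v.env ρ = mk2 (v.app _ xi) (v.app _ xo) := by
    intro U v; simp only [ρ, env_cons, env_nil, mk2]
  have hLt : ∀ (U : Type) (v : Val U), Holds v (l true) ↔
      φ.Sat (mk3 (v.app _ xi) (v.app _ xa) (v.app _ xo)) := by
    intro U v; simp [Holds, l, Item.holds, eL]
  have hLf : ∀ (U : Type) (v : Val U), Holds v (l false) ↔
      χ.Sat (mk3 (v.app _ xi) (v.app _ xo) (v.app _ xp)) := by
    intro U v; simp [Holds, l, Item.holds, eR]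
  have hsep : Sep [Ti, To] ρ l := by
    by_contra hins
    have di : ∀ b, ok (SP [Ti, To] ρ (M3 + M4) b) Ti xi := by
      intro b
      have := ok_and Ti xi ok1 (ok_dfn ρ Ti (v0 Ti))
      exact ok_mono (fun _ n h => ⟨by have := h.1.2; omega, Or.inr ⟨h.1.1, h.2⟩⟩) _ _ this
    have d_o : ∀ b, ok (SP [Ti, To] ρ (M3 + M4) b) To xo := by
      intro b
      have := ok_and To xo ok2 (ok_dfn ρ To (wk Ti (v0 To)))
      exact ok_mono (fun _ n h => ⟨by have := h.1.2; omega, Or.inr ⟨h.1.1, h.2⟩⟩) _ _ this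
    have da : ok (SP [Ti, To] ρ (M3 + M4) true) Ta xa :=
      ok_mono (fun _ n h => ⟨by have := h.2; omega, Or.inl h.1⟩) _ _ ok3
    have dp : ok (SP [Ti, To] ρ (M3 + M4) false) Tp xp :=
      ok_mono (fun _ n h => ⟨by have := h.2; omega, Or.inl h.1⟩) _ _ ok4
    let p : St :=
      { Γ := [Ti, To]
        ρ := ρ
        l := l
        N := M3 + M4
        okr := okE_cons _ _ (ok_mono (fun _ n h => h.1) _ _ (di true))
          (okE_cons _ _ (ok_mono (fun _ n h => h.1) _ _ (d_o true)) okE_nil)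
        okl := by
          intro b A hA
          cases b with
          | true =>
            have e : A = .fml _ φ ρL := List.mem_singleton.1 hA
            rw [e]
            exact okE_cons _ _ (di _) (okE_cons _ _ da (okE_cons _ _ (d_o _) okE_nil))
          | false =>
            have e : A = .fml _ χ ρR := List.mem_singleton.1 hA
            rw [e]
            exact okE_cons _ _ (di _) (okE_cons _ _ (d_o _) (okE_cons _ _ dp okE_nil))
        sync := by
          intro b T x s hA
          cases b with
          | true => exact absurd (List.mem_singleton.1 hA) (by simp)
          | false => exact absurd (List.mem_singleton.1 hA) (by simp)
        insep := hins }
    obtain ⟨U, v, hv⟩ := exists_model p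
    have : Nonempty U := ⟨v.u (none, 0)⟩
    exact h U _ _ _ _ ((hLt U v).1 (hv true)) ((hLf U v).1 (hv false))
  obtain ⟨θ, h1, h2⟩ := hsep
  have base : ∀ (U : Type) [Nonempty U] (i : NObj U Ti) (o : NObj U To), ∃ v : Val U,
      v.app _ xi = i ∧ v.app _ xo = o := by
    intro U hU i o
    obtain ⟨u⟩ := hU
    obtain ⟨w1, e1, _⟩ := f1 U ⟨fun _ => u, fun _ _ => ∅⟩ i
    obtain ⟨w2, e2, g2⟩ := f2 U w1 o
    exact ⟨w2, by rw [← e1]; exact (app_agree g2 _ _ (ok_mono (fun _ n h => h.2) _ _ ok1)).symm, e2⟩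
  refine ⟨θ, ?_, ?_⟩
  · intro U _ i a o hφ
    obtain ⟨w, ei, eo⟩ := base U i o
    obtain ⟨v, ea, g⟩ := f3 U w a
    have ei' := app_agree g _ xi (ok_mono (fun _ n h => lt_of_lt_of_le h.2 hM2) _ _ ok1)
    have eo' := app_agree g _ xo (ok_mono (fun _ n h => h.2) _ _ ok2)
    have := h1 U v ((hLt U v).2 (by rw [ea, ← ei', ← eo', ei, eo]; exact hφ))
    rwa [eC, ← ei', ← eo', ei, eo] at this
  · intro U _ i o p hχ
    obtain ⟨w, ei, eo⟩ := base U i o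
    obtain ⟨v, ea, g⟩ := f4 U w p
    have ei' := app_agree g _ xi (ok_mono (fun _ n h => lt_of_lt_of_le h.2 hM2) _ _ ok1)
    have eo' := app_agree g _ xo (ok_mono (fun _ n h => h.2) _ _ ok2)
    have := h2 U v ((hLf U v).2 (by rw [ea, ← ei', ← eo', ei, eo]; exact hχ))
    rwa [eC, ← ei', ← eo', ei, eo] at this

/-- Substitutions given by lists of terms. -/
def Sub.nil {Δ : List NTy} : Sub [] Δ := fun i => i.elim0

def Sub.cons {T : NTy} {Γ Δ : List NTy} (x : Tm Δ T) (σ : Sub Γ Δ) : Sub (T :: Γ) Δ := fun i =>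
  Fin.cases (motive := fun i => Tm Δ ((T :: Γ).get i)) x (fun j => σ j) i

theorem Sub.ev_nil {U : Type} {Δ : List NTy} (ρ : Env U Δ) :
    (Sub.nil (Δ := Δ)).ev ρ = Env.nil := by
  funext i; exact i.elim0

theorem Sub.ev_cons {U : Type} {T : NTy} {Γ Δ : List NTy} (x : Tm Δ T) (σ : Sub Γ Δ)
    (ρ : Env U Δ) : (Sub.cons x σ).ev ρ = Env.cons (x.eval ρ) (σ.ev ρ) := by
  funext i
  refine Fin.cases (motive := fun i => (Sub.cons x σ).ev ρ i
    = Env.cons (x.eval ρ) (σ.ev ρ) i) ?_ (fun j => ?_) i <;> rfl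

theorem Sub.fv_cons {T : NTy} {Γ Δ : List NTy} (x : Tm Δ T) (σ : Sub Γ Δ)
    (S : Finset (Fin Δ.length)) (hx : x.fv ⊆ S) (hs : ∀ i, (σ i).fv ⊆ S) :
    ∀ i, ((Sub.cons x σ) i).fv ⊆ S := by
  intro i
  exact Fin.cases (motive := fun i => ((Sub.cons x σ) i).fv ⊆ S) hx (fun j => hs j) i

section three

variable (A B C : NTy)

def t0 : Tm [A, B, C] A := v0 A
def t1 : Tm [A, B, C] B := wk A (v0 B)
def t2 : Tm [A, B, C] C := wk A (wk B (v0 C))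

theorem eval_t0 {U : Type} (a : NObj U A) (b : NObj U B) (c : NObj U C) :
    (t0 A B C).eval (mk3 a b c) = a := eval_v0 _ _

theorem eval_t1 {U : Type} (a : NObj U A) (b : NObj U B) (c : NObj U C) :
    (t1 A B C).eval (mk3 a b c) = b := by
  simp only [t1, mk3, eval_wk, eval_v0]

theorem eval_t2 {U : Type} (a : NObj U A) (b : NObj U B) (c : NObj U C) :
    (t2 A B C).eval (mk3 a b c) = c := by
  simp only [t2, mk3, eval_wk, eval_v0]

theorem eval_fst_t2 {U : Type} {D : NTy} (a : NObj U A) (b : NObj U B)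
    (p : NObj U (.prod C D)) :
    (Tm.fst (t2 A B (.prod C D))).eval (mk3 a b p)
      = Prod.fst (α := NObj U C) (β := NObj U D) p := by
  have h := congrArg (fun q : NObj U C × NObj U D => q.1) (eval_t2 A B (.prod C D) a b p)
  simp only [Tm.eval]
  exact h

theorem eval_snd_t2 {U : Type} {D : NTy} (a : NObj U A) (b : NObj U B)
    (p : NObj U (.prod C D)) :
    (Tm.snd (t2 A B (.prod C D))).eval (mk3 a b p)
      = Prod.snd (α := NObj U C) (β := NObj U D) p := by
  have h := congrArg (fun q : NObj U C × NObj U D => q.2) (eval_t2 A B (.prod C D) a b p)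
  simp only [Tm.eval]
  exact h

theorem fv_t0 : (t0 A B C).fv = ({0} : Finset (Fin 3)) := fv_var (Γ := [A, B, C]) (0 : Fin 3)

theorem fv_t2 : (t2 A B C).fv = ({2} : Finset (Fin 3)) := fv_var (Γ := [A, B, C]) (2 : Fin 3)

end three

theorem main {Ti Ta To : NTy} (Sg : D0 [Ti, Ta, To])
    (himp : ∀ (U : Type) (i : NObj U Ti) (a : NObj U Ta) (o : NObj U To)
      (a' : NObj U Ta) (o' : NObj U To),
      Sg.Sat (mk3 i a o) → Sg.Sat (mk3 i a' o') → o = o') :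
    ∃ Sg' : D0 [Ti, Ta, To],
      Sg'.fv ⊆ ({0, 2} : Finset (Fin 3)) ∧
      (∀ (U : Type) (i : NObj U Ti) (a : NObj U Ta) (o : NObj U To)
        (a' : NObj U Ta) (o' : NObj U To),
        Sg'.Sat (mk3 i a o) → Sg'.Sat (mk3 i a' o') → o = o') ∧
      (∀ (U : Type) (i : NObj U Ti) (a : NObj U Ta) (o : NObj U To),
        Sg.Sat (mk3 i a o) → Sg'.Sat (mk3 i a o)) := by
  -- first interpolation
  let σ1 : Sub [Ti, Ta, To] [Ti, To, NTy.prod Ta To] :=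
    Sub.cons (t0 Ti To (NTy.prod Ta To)) (Sub.cons (.fst (t2 Ti To (NTy.prod Ta To))) (Sub.cons (.snd (t2 Ti To (NTy.prod Ta To))) Sub.nil))
  have ev1 : ∀ (U : Type) (i : NObj U Ti) (o : NObj U To) (p : NObj U (NTy.prod Ta To)),
      σ1.ev (mk3 i o p) = mk3 i (Prod.fst (α := NObj U Ta) (β := NObj U To) p)
        (Prod.snd (α := NObj U Ta) (β := NObj U To) p) := by
    intro U i o p
    simp only [σ1, Sub.ev_cons, Sub.ev_nil]
    rw [eval_t0]
    have e1 := eval_fst_t2 Ti To Ta (D := To) i o p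
    have e2 := eval_snd_t2 Ti To Ta (D := To) i o p
    exact congrArg₂ (fun x y => mk3 (Ti := Ti) i x y) e1 e2
  obtain ⟨θ, a1, a2⟩ := interp Sg
    (.and (subst σ1 Sg) (neg (eqF To (t1 Ti To (NTy.prod Ta To)) (.snd (t2 Ti To (NTy.prod Ta To))))))
    (by
      rintro U _ i a o p h ⟨h1, h2⟩
      have h1' := (sat_subst _ _ _).1 h1
      have h3 := ev1 U i o p
      have h1'' : Sg.Sat (mk3 i (Prod.fst (α := NObj U Ta) (β := NObj U To) p)
        (Prod.snd (α := NObj U Ta) (β := NObj U To) p)) := h3 ▸ h1'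
      rw [sat_neg, sat_eqF] at h2
      exact h2 ((eval_t1 Ti To _ i o p).trans ((himp U i a o _ _ h h1'').trans
        (eval_snd_t2 Ti To Ta (D := To) i o p).symm)))
  have b2 : ∀ (U : Type) [Nonempty U] (i : NObj U Ti) (o : NObj U To) (a' : NObj U Ta)
      (o' : NObj U To), θ.Sat (mk2 i o) → Sg.Sat (mk3 i a' o') → o = o' := by
    intro U _ i o a' o' h1 h2
    by_contra hne
    refine a2 U i o ((a', o') : NObj U Ta × NObj U To) ⟨?_, ?_⟩ h1
    · have h3 := ev1 U i o (a', o')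
      refine (sat_subst _ _ _).2 ?_
      exact h3.symm ▸ h2
    · rw [sat_neg, sat_eqF]
      intro e
      exact hne ((eval_t1 Ti To _ i o _).symm.trans (e.trans
        (eval_snd_t2 Ti To Ta (D := To) i o (a', o'))))
  -- second interpolation
  let σ2 : Sub [Ti, To] [Ti, To, To] :=
    Sub.cons (t0 Ti To To) (Sub.cons (t2 Ti To To) Sub.nil)
  have ev2 : ∀ (U : Type) (i : NObj U Ti) (o p : NObj U To),
      σ2.ev (mk3 i o p) = mk2 i p := by
    intro U i o p
    simp only [σ2, Sub.ev_cons, Sub.ev_nil, eval_t0, eval_t2]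
    rfl
  obtain ⟨θ', c1, c2⟩ := interp Sg
    (.and (subst σ2 θ) (neg (eqF To (t1 Ti To To) (t2 Ti To To))))
    (by
      rintro U _ i a o p h ⟨h1, h2⟩
      rw [sat_subst, ev2] at h1
      rw [sat_neg, sat_eqF] at h2
      simp only [eval_t1, eval_t2] at h2
      exact h2 (b2 U i p a o h1 h).symm)
  have d2 : ∀ (U : Type) [Nonempty U] (i : NObj U Ti) (o o' : NObj U To),
      θ'.Sat (mk2 i o) → θ.Sat (mk2 i o') → o = o' := by
    intro U _ i o o' h1 h2
    by_contra hne
    refine c2 U i o o' ⟨?_, ?_⟩ h1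
    · rw [sat_subst, ev2]; exact h2
    · rw [sat_neg, sat_eqF]
      simp only [eval_t1, eval_t2]
      exact hne
  -- conclusion
  let σ3 : Sub [Ti, To] [Ti, Ta, To] :=
    Sub.cons (t0 Ti Ta To) (Sub.cons (t2 Ti Ta To) Sub.nil)
  have ev3 : ∀ (U : Type) (i : NObj U Ti) (a : NObj U Ta) (o : NObj U To),
      σ3.ev (mk3 i a o) = mk2 i o := by
    intro U i a o
    simp only [σ3, Sub.ev_cons, Sub.ev_nil, eval_t0, eval_t2]
    rfl
  have hsat : ∀ (U : Type) (i : NObj U Ti) (a : NObj U Ta) (o : NObj U To),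
      (D0.and (subst σ3 θ) (subst σ3 θ')).Sat (mk3 i a o) ↔
        θ.Sat (mk2 i o) ∧ θ'.Sat (mk2 i o) := by
    intro U i a o
    simp only [D0.Sat, sat_subst, ev3]
  have hmp : ∀ (U : Type) (i : NObj U Ti) (a : NObj U Ta) (o : NObj U To),
      mpE (some : U → Option U) (mk3 i a o) = mk3 (mp some _ i) (mp some _ a) (mp some _ o) := by
    intro U i a o
    simp only [mk3, mpE_cons]
    congr 3
    funext i; exact i.elim0
  have inj : ∀ U : Type, Function.Injective (some : U → Option U) := Option.some_injective
  refine ⟨.and (subst σ3 θ) (subst σ3 θ'), ?_, ?_, ?_⟩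
  · have q0 : ({0} : Finset (Fin 3)) ⊆ {0, 2} := by decide
    have q2 : ({2} : Finset (Fin 3)) ⊆ {0, 2} := by decide
    have hσ : ∀ i, (σ3 i).fv ⊆ ({0, 2} : Finset (Fin 3)) := by
      refine Sub.fv_cons _ _ _ ?_ (Sub.fv_cons _ _ _ ?_ (fun i => i.elim0))
      · exact (fv_t0 Ti Ta To).subset.trans q0
      · exact (fv_t2 Ti Ta To).subset.trans q2
    simp only [D0.fv]
    exact Finset.union_subset (fv_subst θ σ3 _ hσ) (fv_subst θ' σ3 _ hσ)
  · intro U i a o a' o' h h'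
    apply mp_inj some (inj U) To
    rw [← sat_mp some (inj U), hmp, hsat] at h h'
    exact d2 (Option U) _ _ _ h.2 h'.1
  · intro U i a o h
    rw [← sat_mp some (inj U), hmp] at h ⊢
    rw [hsat]
    exact ⟨a1 _ _ _ _ h, c1 _ _ _ _ h⟩

end DropPar

/-- **Dropping auxiliary parameters from implicit definitions** (Lemma 3.4): if a Δ₀
formula `Σ(i, a, o)` implicitly defines `o` as a function of `i`, then there is a Δ₀
formula `Σ'(i, o)` not mentioning the auxiliary parameter `a` (its free variables are
among `i` and `o`) which also implicitly defines `o` as a function of `i`, and such that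
`Σ(i,a,o)` entails `Σ'(i,o)`. -/
theorem d0_drop_parameters {Ti Ta To : NTy} (Sg : D0 [Ti, Ta, To])
    (himp : ∀ (U : Type) (i : NObj U Ti) (a : NObj U Ta) (o : NObj U To)
      (a' : NObj U Ta) (o' : NObj U To),
      Sg.Sat (mk3 i a o) → Sg.Sat (mk3 i a' o') → o = o') :
    ∃ Sg' : D0 [Ti, Ta, To],
      Sg'.fv ⊆ ({0, 2} : Finset (Fin 3)) ∧
      (∀ (U : Type) (i : NObj U Ti) (a : NObj U Ta) (o : NObj U To)
        (a' : NObj U Ta) (o' : NObj U To),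
        Sg'.Sat (mk3 i a o) → Sg'.Sat (mk3 i a' o') → o = o') ∧
      (∀ (U : Type) (i : NObj U Ti) (a : NObj U Ta) (o : NObj U To),
        Sg.Sat (mk3 i a o) → Sg'.Sat (mk3 i a o)) := by
  exact DropPar.main Sg himp
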